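/- arXiv:1703.02173 — 7 statements merged into one kernel-verified Lean document; each statement's English description precedes it below -/
import Mathlib

section
/- For all sufficiently large n there exist universal constants c₀, c₁, C > 0 such that for every R with c₀√n ≤ R ≤ c₁n there exists a convex body K ⊂ ℝⁿ in John's position (with the unit Euclidean ball B₂ⁿ as its maximal-volume inscribed ellipsoid, centered at the origin) such that every polytope P of the form P = {x ∈ ℝⁿ : ⟨x, w_l⟩ ≤ 1 for l = 1, …, m} satisfying K ⊆ P ⊆ R·K must have m ≥ exp(C · log(R²/n) · n²/R²). -/
open MeasureTheory RealInnerProductSpace Pointwise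

/-- A convex body: compact, convex, with nonempty interior. -/
def IsConvexBody {n : ℕ} (K : Set (EuclideanSpace ℝ (Fin n))) : Prop :=
  IsCompact K ∧ Convex ℝ K ∧ (interior K).Nonempty

/-- An ellipsoid: the image of the unit Euclidean ball under an invertible affine map. -/
def IsEllipsoid {n : ℕ} (E : Set (EuclideanSpace ℝ (Fin n))) : Prop :=
  ∃ T : EuclideanSpace ℝ (Fin n) ≃ᵃ[ℝ] EuclideanSpace ℝ (Fin n),
    E = T '' (Metric.closedBall 0 1)

/-- A convex body is in John's position if it contains the unit ball and every ellipsoid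
contained in it has volume at most that of the unit ball. -/
def InJohnPosition {n : ℕ} (K : Set (EuclideanSpace ℝ (Fin n))) : Prop :=
  Metric.closedBall 0 1 ⊆ K ∧
    ∀ E : Set (EuclideanSpace ℝ (Fin n)), IsEllipsoid E → E ⊆ K →
      volume E ≤ volume (Metric.closedBall (0 : EuclideanSpace ℝ (Fin n)) 1)


/-- Singular value decomposition of an injective endomorphism of `ℝⁿ`. -/
theorem exists_orthonormalBasis_map_eq_smul {n : ℕ}
    (A : EuclideanSpace ℝ (Fin n) →ₗ[ℝ] EuclideanSpace ℝ (Fin n)) (hA : Function.Injective A) :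
    ∃ (e f : OrthonormalBasis (Fin n) ℝ (EuclideanSpace ℝ (Fin n))) (σ : Fin n → ℝ),
      (∀ i, 0 ≤ σ i) ∧ (∀ i, A (e i) = σ i • f i) ∧ |LinearMap.det A| = ∏ i, σ i := by
  have hn : Module.finrank ℝ (EuclideanSpace ℝ (Fin n)) = n := by simp
  have hS := A.isSymmetric_adjoint_comp_self
  set e := hS.eigenvectorBasis hn
  set σ : Fin n → ℝ := fun i => A.singularValues i
  have hsq : ∀ i, σ i ^ 2 = hS.eigenvalues hn i := fun i => A.sq_singularValues_fin hn i
  have hinner : ∀ i j, ⟪A (e i), A (e j)⟫ = if i = j then σ i ^ 2 else 0 := by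
    intro i j
    rw [← LinearMap.adjoint_inner_left]
    have h1 : A.adjoint (A (e i)) = (hS.eigenvalues hn i) • e i := by
      exact hS.apply_eigenvectorBasis hn i
    rw [h1, inner_smul_left, ← hsq, orthonormal_iff_ite.mp e.orthonormal i j]
    simp
  have hpos : ∀ i, σ i ≠ 0 := by
    intro i h0
    have h := hinner i i
    rw [h0] at h
    simp only [if_true, ne_eq, OfNat.ofNat_ne_zero, not_false_eq_true, zero_pow,
      inner_self_eq_zero] at h
    have h2 : e i = 0 := hA (by rw [h, map_zero])
    exact e.orthonormal.ne_zero i h2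
  have hf : Orthonormal ℝ (Set.univ.domRestrict fun i => (σ i)⁻¹ • A (e i)) := by
    rw [orthonormal_iff_ite]
    rintro ⟨i, hi⟩ ⟨j, hj⟩
    simp only [Set.domRestrict_apply, inner_smul_left, inner_smul_right, hinner, Subtype.mk.injEq]
    split_ifs with h
    · subst h
      have := hpos i
      simp only [conj_trivial]
      field_simp
    · simp
  obtain ⟨f, hf'⟩ := hf.exists_orthonormalBasis_extension_of_card_eq (by simp)
  refine ⟨e, f, σ, fun i => A.singularValues_nonneg i, fun i => ?_, ?_⟩
  · rw [hf' i (Set.mem_univ i), smul_inv_smul₀ (hpos i)]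
  · rw [← LinearMap.normDet_eq_abs_det, LinearMap.normDet_eq_prod_singularValues, hn,
      Finset.prod_range]

/-- The sufficiency direction of John's theorem: a body is in John's position as soon as it lies
between the unit ball and a polytope whose unit normals are the contact points of a centred
decomposition of the identity. -/
theorem inJohnPosition_of_decomposition {n : ℕ} {ι : Type*} [Fintype ι]
    {K : Set (EuclideanSpace ℝ (Fin n))} (y : ι → EuclideanSpace ℝ (Fin n)) (c : ι → ℝ)
    (hc : ∀ a, 0 ≤ c a) (hy : ∀ a, ‖y a‖ = 1) (hsum : ∑ a, c a • y a = 0)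
    (hframe : ∀ x, ∑ a, c a * ⟪x, y a⟫ ^ 2 = ‖x‖ ^ 2)
    (hball : Metric.closedBall 0 1 ⊆ K) (hK : ∀ x ∈ K, ∀ a, ⟪x, y a⟫ ≤ 1) :
    InJohnPosition K := by
  refine ⟨hball, ?_⟩
  rintro _ ⟨T, rfl⟩ hT
  set A : EuclideanSpace ℝ (Fin n) →ₗ[ℝ] EuclideanSpace ℝ (Fin n) :=
    (T.linear : EuclideanSpace ℝ (Fin n) →ₗ[ℝ] EuclideanSpace ℝ (Fin n))
  have hTx : ∀ x, T x = A x + T 0 := fun x => by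
    have := T.map_vadd 0 x
    rwa [vadd_eq_add, vadd_eq_add, add_zero] at this
  obtain ⟨e, f, σ, hσ, hAe, hdet⟩ :=
    exists_orthonormalBasis_map_eq_smul A T.linear.injective
  have hcsum : ∑ a, c a = n := by
    have h1 : ∀ a, ∑ i, ⟪f i, y a⟫ ^ 2 = 1 := fun a => by
      have := f.sum_sq_norm_inner_right (y a)
      simpa [hy a] using this
    calc ∑ a, c a = ∑ a, c a * ∑ i, ⟪f i, y a⟫ ^ 2 := by simp [h1]
      _ = ∑ i, ∑ a, c a * ⟪f i, y a⟫ ^ 2 := by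
        simp_rw [Finset.mul_sum]
        exact Finset.sum_comm
      _ = n := by simp [hframe]
  have hkey : ∀ a, ∑ i, σ i * ⟪f i, y a⟫ ^ 2 + ⟪T 0, y a⟫ ≤ 1 := by
    intro a
    set x : EuclideanSpace ℝ (Fin n) := ∑ i, ⟪f i, y a⟫ • e i with hx
    have hxn : ‖x‖ = 1 := by
      have h1 : ‖x‖ ^ 2 = 1 := by
        rw [← e.sum_sq_norm_inner_right x]
        have h2 : ∀ i, ⟪e i, x⟫ = ⟪f i, y a⟫ := fun i => by
          rw [hx, e.orthonormal.inner_right_fintype]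
        simp_rw [h2]
        rw [f.sum_sq_norm_inner_right, hy a, one_pow]
      nlinarith [norm_nonneg x]
    have h3 := hK (T x) (hT ⟨x, by simp [hxn], rfl⟩) a
    rw [hTx, inner_add_left] at h3
    convert h3 using 2
    rw [hx, map_sum, sum_inner]
    refine Finset.sum_congr rfl fun i _ => ?_
    rw [map_smul, hAe, inner_smul_left, inner_smul_left]
    simp only [conj_trivial]
    ring
  have htrace : ∑ i, σ i ≤ n := by
    calc ∑ i, σ i = ∑ i, σ i * ∑ a, c a * ⟪f i, y a⟫ ^ 2 := by simp [hframe]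
      _ = ∑ a, c a * ∑ i, σ i * ⟪f i, y a⟫ ^ 2 := by
        simp_rw [Finset.mul_sum]
        rw [Finset.sum_comm]
        exact Finset.sum_congr rfl fun a _ => Finset.sum_congr rfl fun i _ => by ring
      _ = ∑ a, c a * (∑ i, σ i * ⟪f i, y a⟫ ^ 2 + ⟪T 0, y a⟫) := by
        simp_rw [mul_add, Finset.sum_add_distrib]
        have : ∑ a, c a * ⟪T 0, y a⟫ = ⟪T 0, ∑ a, c a • y a⟫ := by
          simp [inner_sum, inner_smul_right]
        rw [this, hsum, inner_zero_right, add_zero]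
      _ ≤ ∑ a, c a * 1 :=
        Finset.sum_le_sum fun a _ => mul_le_mul_of_nonneg_left (hkey a) (hc a)
      _ = n := by simp [hcsum]
  have hdet1 : |LinearMap.det A| ≤ 1 := by
    rw [hdet]
    calc ∏ i, σ i ≤ ∏ i, Real.exp (σ i - 1) :=
        Finset.prod_le_prod (fun i _ => hσ i) fun i _ => by
          have := Real.add_one_le_exp (σ i - 1)
          linarith
      _ = Real.exp (∑ i, σ i - n) := by rw [← Real.exp_sum]; simp
      _ ≤ 1 := by rw [Real.exp_le_one_iff]; linarith
  have himage : T '' Metric.closedBall 0 1 =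
      (fun z => z + T 0) '' (A '' Metric.closedBall 0 1) := by
    rw [Set.image_image]
    exact Set.image_congr fun x _ => hTx x
  rw [himage, Set.image_add_right, measure_preimage_add_right,
    Measure.addHaar_image_linearMap]
  calc _ ≤ 1 * volume (Metric.closedBall (0 : EuclideanSpace ℝ (Fin n)) 1) := by
        gcongr
        exact ENNReal.ofReal_le_one.mpr hdet1
    _ = _ := one_mul _

/-- The `n + 1` vertices of a regular simplex inscribed in the unit sphere of `ℝⁿ`. -/
noncomputable def simplexVertex (n : ℕ) : Option (Fin n) → EuclideanSpace ℝ (Fin n)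
  | none => WithLp.toLp 2 fun _ => -√(1 / n)
  | some j => WithLp.toLp 2 fun i =>
      (if i = j then √(1 + 1 / n) else 0) - (√(1 + 1 / n) - √(1 / n)) / n

theorem inner_simplexVertex_none {n : ℕ} (x : EuclideanSpace ℝ (Fin n)) :
    ⟪x, simplexVertex n none⟫ = -√(1 / n) * ∑ i, x i := by
  simp [simplexVertex, PiLp.inner_apply, Finset.mul_sum]

theorem inner_simplexVertex_some {n : ℕ} (x : EuclideanSpace ℝ (Fin n)) (j : Fin n) :
    ⟪x, simplexVertex n (some j)⟫ =
      √(1 + 1 / n) * x j - (√(1 + 1 / n) - √(1 / n)) / n * ∑ i, x i := by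
  simp [simplexVertex, PiLp.inner_apply, Finset.mul_sum, sub_mul, Finset.sum_sub_distrib]

theorem inner_simplexVertex {n : ℕ} (hn : 1 ≤ n) (a b : Option (Fin n)) :
    ⟪simplexVertex n a, simplexVertex n b⟫ = (if a = b then 1 + 1 / (n : ℝ) else 0) - 1 / n := by
  have hn0 : (n : ℝ) ≠ 0 := by positivity
  have hg : √(1 / (n : ℝ)) ^ 2 = 1 / n := Real.sq_sqrt (by positivity)
  have hs : √(1 + 1 / (n : ℝ)) ^ 2 = 1 + 1 / n := Real.sq_sqrt (by positivity)
  cases b with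
  | none =>
    rw [inner_simplexVertex_none]
    cases a with
    | none =>
      simp only [simplexVertex, Finset.sum_const, Finset.card_univ, Fintype.card_fin,
        nsmul_eq_mul, if_true]
      have : -√(1 / (n : ℝ)) * (n * -√(1 / n)) = n * √(1 / (n : ℝ)) ^ 2 := by ring
      rw [this, hg]
      field_simp
      ring
    | some j =>
      simp only [simplexVertex, Finset.sum_sub_distrib, Finset.sum_ite_eq', Finset.mem_univ,
        if_true, Finset.sum_const, Finset.card_univ, Fintype.card_fin, nsmul_eq_mul,
        reduceCtorEq, if_false]
      rw [mul_div_cancel₀ _ hn0]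
      linear_combination -hg
  | some k =>
    rw [inner_simplexVertex_some]
    cases a with
    | none =>
      simp only [simplexVertex, Finset.sum_const, Finset.card_univ, Fintype.card_fin,
        nsmul_eq_mul, reduceCtorEq, if_false]
      have : (√(1 + 1 / (n : ℝ)) - √(1 / n)) / n * (n * -√(1 / (n : ℝ))) =
        -(√(1 + 1 / (n : ℝ)) - √(1 / n)) * √(1 / (n : ℝ)) := by field_simp
      rw [this]
      linear_combination -hg
    | some j =>
      simp only [simplexVertex, Finset.sum_sub_distrib, Finset.sum_ite_eq', Finset.mem_univ,
        if_true, Finset.sum_const, Finset.card_univ, Fintype.card_fin, nsmul_eq_mul,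
        Option.some.injEq, eq_comm (a := k)]
      rw [mul_div_cancel₀ _ hn0]
      split_ifs with h
      · linear_combination (1 - 1 / (n : ℝ)) * hs + 1 / (n : ℝ) * hg
      · linear_combination (-1 / (n : ℝ)) * hs + 1 / (n : ℝ) * hg

theorem norm_simplexVertex {n : ℕ} (hn : 1 ≤ n) (a : Option (Fin n)) :
    ‖simplexVertex n a‖ = 1 := by
  have h := inner_simplexVertex hn a a
  rw [real_inner_self_eq_norm_sq] at h
  simp only [if_true, add_sub_cancel_right] at h
  nlinarith [norm_nonneg (simplexVertex n a)]

theorem sum_inner_simplexVertex_sq {n : ℕ} (hn : 1 ≤ n) (x : EuclideanSpace ℝ (Fin n)) :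
    ∑ a, ⟪x, simplexVertex n a⟫ ^ 2 = (1 + 1 / n) * ‖x‖ ^ 2 := by
  have hn0 : (n : ℝ) ≠ 0 := by positivity
  have hg : √(1 / (n : ℝ)) ^ 2 = 1 / n := Real.sq_sqrt (by positivity)
  have hs : √(1 + 1 / (n : ℝ)) ^ 2 = 1 + 1 / n := Real.sq_sqrt (by positivity)
  rw [Fintype.sum_option, inner_simplexVertex_none, EuclideanSpace.real_norm_sq_eq]
  simp_rw [inner_simplexVertex_some]
  set t := ∑ i, x i with ht
  set s := √(1 + 1 / (n : ℝ))
  set g := √(1 / (n : ℝ))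
  have : ∀ j, (s * x j - (s - g) / n * t) ^ 2 =
      s ^ 2 * x j ^ 2 - 2 * s * ((s - g) / n * t) * x j + ((s - g) / n * t) ^ 2 := fun j => by ring
  simp_rw [this, Finset.sum_add_distrib, Finset.sum_sub_distrib, ← Finset.mul_sum, ← ht]
  simp only [Finset.sum_const, Finset.card_univ, Fintype.card_fin, nsmul_eq_mul]
  have h2 : (n : ℝ) * ((s - g) / n * t) ^ 2 = (s - g) ^ 2 / n * t ^ 2 := by field_simp
  have h3 : 2 * s * ((s - g) / n * t) * t = 2 * s * (s - g) / n * t ^ 2 := by ring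
  rw [h2, h3]
  linear_combination (∑ i, x i ^ 2) * hs - t ^ 2 / n * hs + (t ^ 2 + t ^ 2 / n) * hg

theorem sum_simplexVertex {n : ℕ} (hn : 1 ≤ n) : ∑ a, simplexVertex n a = 0 := by
  rw [← inner_self_eq_zero (𝕜 := ℝ), sum_inner]
  refine Finset.sum_eq_zero fun a _ => ?_
  rw [inner_sum]
  simp_rw [inner_simplexVertex hn, Finset.sum_sub_distrib]
  have hn0 : (n : ℝ) ≠ 0 := by positivity
  simp
  field_simp
  ring

theorem isBounded_of_inner_simplexVertex_le {n : ℕ} (hn : 1 ≤ n)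
    {K : Set (EuclideanSpace ℝ (Fin n))} (hK : ∀ x ∈ K, ∀ a, ⟪x, simplexVertex n a⟫ ≤ 1) :
    Bornology.IsBounded K := by
  refine (Metric.isBounded_closedBall (x := 0) (r := ((n : ℝ) + 1) * (n + 1))).subset fun x hx => ?_
  rw [mem_closedBall_zero_iff]
  have hsum : ∑ a, ⟪x, simplexVertex n a⟫ = 0 := by
    rw [← inner_sum, sum_simplexVertex hn, inner_zero_right]
  have hlow : ∀ a, -((n : ℝ) + 1) ≤ ⟪x, simplexVertex n a⟫ - 1 := by
    intro a
    have h1 : ∑ b, (1 - ⟪x, simplexVertex n b⟫) = n + 1 := by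
      rw [Finset.sum_sub_distrib, hsum]
      simp
    have h2 := Finset.single_le_sum (f := fun b => 1 - ⟪x, simplexVertex n b⟫)
      (fun b _ => sub_nonneg.mpr (hK x hx b)) (Finset.mem_univ a)
    linarith
  have hnn : (1 : ℝ) ≤ n := by exact_mod_cast hn
  have hsq : ∀ a, ⟪x, simplexVertex n a⟫ ^ 2 ≤ ((n : ℝ) + 1) ^ 2 := fun a => by
    apply sq_le_sq'
    · linarith [hlow a]
    · linarith [hK x hx a]
  have h4 := Finset.sum_le_sum fun a (_ : a ∈ Finset.univ) => hsq a
  rw [sum_inner_simplexVertex_sq hn] at h4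
  simp only [Finset.sum_const, Finset.card_univ, Fintype.card_option, Fintype.card_fin,
    nsmul_eq_mul] at h4
  push_cast at h4
  have h5 : 0 ≤ 1 / (n : ℝ) * ‖x‖ ^ 2 := by positivity
  have h6 : ‖x‖ ^ 2 ≤ (((n : ℝ) + 1) * (n + 1)) ^ 2 := by nlinarith [sq_nonneg ((n : ℝ) + 1)]
  exact abs_le_of_sq_le_sq' h6 (by positivity) |>.2

/-- A Gilbert–Varshamov bound for `q`-ary words of length `k` with relative distance one half. -/
theorem exists_code {k q : ℕ} (hk : 1 ≤ k) (hq : 16 ≤ q) :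
    ∃ F : Finset (Fin k → Fin q),
      (∀ f ∈ F, ∀ g ∈ F, f ≠ g → 2 * (Finset.univ.filter fun i => f i = g i).card ≤ k) ∧
      q ^ k ≤ F.card ^ 4 := by
  classical
  obtain ⟨F, hF⟩ := Set.Finite.exists_maximal (s := {F : Finset (Fin k → Fin q) |
    ∀ f ∈ F, ∀ g ∈ F, f ≠ g → 2 * (Finset.univ.filter fun i => f i = g i).card ≤ k})
    (Set.toFinite _) ⟨∅, by simp⟩
  have hFp := hF.prop
  refine ⟨F, hFp, ?_⟩
  have hcover : ∀ g : Fin k → Fin q, ∃ f ∈ F,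
      k < 2 * (Finset.univ.filter fun i => f i = g i).card := by
    intro g
    by_cases hg : g ∈ F
    · exact ⟨g, hg, by simp; omega⟩
    by_contra! hcon
    have hins : insert g F ∈ {F : Finset (Fin k → Fin q) |
        ∀ f ∈ F, ∀ g ∈ F, f ≠ g → 2 * (Finset.univ.filter fun i => f i = g i).card ≤ k} := by
      intro a ha b hb hab
      rcases Finset.mem_insert.mp ha with rfl | ha' <;> rcases Finset.mem_insert.mp hb with rfl | hb'
      · exact absurd rfl hab
      · simpa [eq_comm] using hcon b hb'
      · exact hcon a ha'
      · exact hFp a ha' b hb' hab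
    exact hg (hF.le_of_ge hins (Finset.subset_insert g F) (Finset.mem_insert_self g F))
  have hball : ∀ f : Fin k → Fin q,
      (Finset.univ.filter fun g : Fin k → Fin q =>
        k < 2 * (Finset.univ.filter fun i => f i = g i).card).card ≤ 2 ^ k * q ^ (k / 2) := by
    intro f
    have hsub : (Finset.univ.filter fun g : Fin k → Fin q =>
        k < 2 * (Finset.univ.filter fun i => f i = g i).card) ⊆
        (Finset.univ.filter fun A : Finset (Fin k) => k < 2 * A.card).biUnion fun A =>
          Fintype.piFinset fun i => if i ∈ A then {f i} else Finset.univ := by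
      intro g hg
      rw [Finset.mem_biUnion]
      refine ⟨Finset.univ.filter fun i => f i = g i, by simpa using hg, ?_⟩
      rw [Fintype.mem_piFinset]
      intro i
      by_cases h : f i = g i <;> simp [h]
    refine (Finset.card_le_card hsub).trans ((Finset.card_biUnion_le_card_mul _ _ (q ^ (k / 2))
      ?_).trans ?_)
    · intro A hA
      have hA' : k < 2 * A.card := by simpa using hA
      rw [Fintype.card_piFinset]
      have : ∀ i, (if i ∈ A then ({f i} : Finset (Fin q)) else Finset.univ).card =
          if i ∈ A then 1 else q := fun i => by split_ifs <;> simp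
      simp_rw [this]
      rw [Finset.prod_ite]
      simp only [Finset.prod_const_one, Finset.prod_const, one_mul]
      refine Nat.pow_le_pow_right (by omega) ?_
      have h1 : (Finset.univ.filter fun i => i ∉ A) = Aᶜ := by ext; simp
      rw [h1, Finset.card_compl, Fintype.card_fin]
      omega
    · gcongr
      refine (Finset.card_le_univ _).trans ?_
      simp
  have hcount : q ^ k ≤ F.card * (2 ^ k * q ^ (k / 2)) := by
    calc q ^ k = (Finset.univ : Finset (Fin k → Fin q)).card := by simp
      _ ≤ (F.biUnion fun f => Finset.univ.filter fun g : Fin k → Fin q =>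
          k < 2 * (Finset.univ.filter fun i => f i = g i).card).card := by
        refine Finset.card_le_card fun g _ => ?_
        obtain ⟨f, hf, h⟩ := hcover g
        exact Finset.mem_biUnion.mpr ⟨f, hf, by simpa using h⟩
      _ ≤ _ := Finset.card_biUnion_le_card_mul _ _ _ fun f _ => hball f
  have hq0 : 0 < q := by omega
  have hsq : q ^ k ≤ F.card ^ 2 * 4 ^ k := by
    have h1 : q ^ k * q ^ k ≤ F.card ^ 2 * 4 ^ k * q ^ k := by
      calc q ^ k * q ^ k ≤ (F.card * (2 ^ k * q ^ (k / 2))) * (F.card * (2 ^ k * q ^ (k / 2))) :=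
            Nat.mul_le_mul hcount hcount
        _ = F.card ^ 2 * 4 ^ k * q ^ (2 * (k / 2)) := by
          rw [show (4 : ℕ) = 2 ^ 2 by norm_num, ← pow_mul, pow_mul']
          ring
        _ ≤ _ := by
          gcongr
          · omega
    exact Nat.le_of_mul_le_mul_right h1 (by positivity)
  have h2 : q ^ k * q ^ k ≤ F.card ^ 4 * q ^ k := by
    calc q ^ k * q ^ k ≤ (F.card ^ 2 * 4 ^ k) * (F.card ^ 2 * 4 ^ k) := Nat.mul_le_mul hsq hsq
      _ = F.card ^ 4 * 16 ^ k := by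
        rw [show (16 : ℕ) = 4 * 4 by norm_num, mul_pow]
        ring
      _ ≤ _ := by gcongr
  exact Nat.le_of_mul_le_mul_right h2 (by positivity)

/-- A bounded set `{x | ∀ l, ⟪x, w l⟫ ≤ 1}` in `ℝⁿ` has at least `n` defining inequalities. -/
theorem le_card_facets_of_isBounded {n m : ℕ} (w : Fin m → EuclideanSpace ℝ (Fin n))
    (hP : Bornology.IsBounded {x : EuclideanSpace ℝ (Fin n) | ∀ l, ⟪x, w l⟫ ≤ 1}) : n ≤ m := by
  by_contra! hlt
  let L : EuclideanSpace ℝ (Fin n) →ₗ[ℝ] (Fin m → ℝ) :=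
    LinearMap.pi fun l => (innerₗ (EuclideanSpace ℝ (Fin n))) (w l)
  obtain ⟨x, hx, hx0⟩ := (Submodule.ne_bot_iff _).mp
    (LinearMap.ker_ne_bot_of_finrank_lt (f := L) (by simpa using hlt))
  have hxw : ∀ l, ⟪x, w l⟫ = 0 := fun l => by
    rw [real_inner_comm]
    exact congrFun (LinearMap.mem_ker.mp hx) l
  obtain ⟨C, hC⟩ := hP.exists_norm_le
  have h := hC (((|C| + 1) / ‖x‖) • x) fun l => by simp [inner_smul_left, hxw l]
  have hxn : 0 < ‖x‖ := norm_pos_iff.mpr hx0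
  rw [norm_smul, Real.norm_eq_abs, abs_of_nonneg (by positivity), div_mul_cancel₀ _ hxn.ne'] at h
  linarith [le_abs_self C]

/-- If the points `x f` violate the constraints `u f` of `K` by a factor between `R` and `B`, but
any two of them violate different constraints, then a facet of a polytope between `K` and `R • K`
separates at most `B` of these points from `K`. -/
theorem card_le_mul_card_facets {n m : ℕ} {ι κ : Type*} (y : ι → EuclideanSpace ℝ (Fin n))
    (F : Finset κ) (x u : κ → EuclideanSpace ℝ (Fin n)) {R B : ℝ} (hR : 0 ≤ R) (hB : 0 ≤ B)
    (hxy : ∀ f ∈ F, ∀ a, ⟪x f, y a⟫ ≤ 1) (hlow : ∀ f ∈ F, R < ⟪x f, u f⟫)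
    (hup : ∀ f ∈ F, ⟪x f, u f⟫ ≤ B) (hne : ∀ f ∈ F, ∀ g ∈ F, f ≠ g → ⟪x f, u g⟫ ≤ 0)
    (w : Fin m → EuclideanSpace ℝ (Fin n))
    (hKP : {z | (∀ a, ⟪z, y a⟫ ≤ 1) ∧ ∀ f ∈ F, ⟪z, u f⟫ ≤ 1} ⊆ {z | ∀ l, ⟪z, w l⟫ ≤ 1})
    (hPK : {z | ∀ l, ⟪z, w l⟫ ≤ 1} ⊆ R • {z | (∀ a, ⟪z, y a⟫ ≤ 1) ∧ ∀ f ∈ F, ⟪z, u f⟫ ≤ 1}) :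
    (F.card : ℝ) ≤ m * B := by
  classical
  rcases F.eq_empty_or_nonempty with rfl | ⟨f₀, hf₀⟩
  · simpa using mul_nonneg m.cast_nonneg hB
  have hsep : ∀ f ∈ F, ∃ l, 1 < ⟪x f, w l⟫ := by
    intro f hf
    by_contra! hall
    obtain ⟨z, hz, hzx⟩ := hPK hall
    have h1 := hlow f hf
    rw [← hzx] at h1
    simp only [inner_smul_left, conj_trivial] at h1
    nlinarith [hz.2 f hf]
  have : Nonempty (Fin m) := ⟨(hsep f₀ hf₀).choose⟩
  choose! l hl using hsep
  have hfiber : ∀ i, ((F.filter fun f => l f = i).card : ℝ) ≤ B := by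
    intro i
    set D := F.filter fun f => l f = i with hD
    by_contra! hlt
    have hDF : ∀ f ∈ D, f ∈ F ∧ l f = i := fun f hf => by simpa [hD] using hf
    have hM : 0 < (D.card : ℝ) := hB.trans_lt hlt
    set z := (D.card : ℝ)⁻¹ • ∑ f ∈ D, x f with hz
    have hzK : z ∈ {z | (∀ a, ⟪z, y a⟫ ≤ 1) ∧ ∀ f ∈ F, ⟪z, u f⟫ ≤ 1} := by
      constructor
      · intro a
        rw [hz, inner_smul_left, sum_inner, conj_trivial, inv_mul_le_iff₀ hM]
        calc ∑ f ∈ D, ⟪x f, y a⟫ ≤ ∑ f ∈ D, (1 : ℝ) :=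
            Finset.sum_le_sum fun f hf => hxy f (hDF f hf).1 a
          _ = D.card * 1 := by simp
      · intro g hg
        rw [hz, inner_smul_left, sum_inner, conj_trivial, inv_mul_le_iff₀ hM, mul_one]
        refine le_trans ?_ hlt.le
        calc ∑ f ∈ D, ⟪x f, u g⟫ ≤ ∑ f ∈ D, if f = g then B else 0 :=
            Finset.sum_le_sum fun f hf => by
              split_ifs with h
              · exact h ▸ hup f (hDF f hf).1
              · exact hne f (hDF f hf).1 g hg h
          _ ≤ B := by
            rw [Finset.sum_ite_eq']
            split_ifs
            · exact le_rfl
            · exact hB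
    have h1 : ⟪z, w i⟫ ≤ 1 := hKP hzK i
    rw [hz, inner_smul_left, sum_inner, conj_trivial, inv_mul_le_iff₀ hM, mul_one] at h1
    have hne' : D.Nonempty := Finset.card_pos.mp (by exact_mod_cast hM)
    have h2 : ∑ f ∈ D, (1 : ℝ) < ∑ f ∈ D, ⟪x f, w i⟫ :=
      Finset.sum_lt_sum_of_nonempty hne' fun f hf => (hDF f hf).2 ▸ hl f (hDF f hf).1
    simp only [Finset.sum_const, nsmul_eq_mul, mul_one] at h2
    linarith
  have hcard := Finset.card_eq_sum_card_fiberwise (f := l) (s := F) (t := Finset.univ)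
    (fun _ _ => Finset.mem_coe.mpr (Finset.mem_univ _))
  rw [hcard]
  push_cast
  calc _ ≤ ∑ _i : Fin m, B := Finset.sum_le_sum fun i _ => hfiber i
    _ = m * B := by simp

/-- A bounded polyhedron containing the unit ball is a convex body. -/
theorem isConvexBody_of_inner_le {n : ℕ} {ι : Type*} (v : ι → EuclideanSpace ℝ (Fin n))
    (hb : Bornology.IsBounded {z | ∀ a, ⟪z, v a⟫ ≤ 1})
    (hball : Metric.closedBall 0 1 ⊆ {z | ∀ a, ⟪z, v a⟫ ≤ 1}) :
    IsConvexBody {z | ∀ a, ⟪z, v a⟫ ≤ 1} := by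
  refine ⟨Metric.isCompact_of_isClosed_isBounded ?_ hb, ?_, ?_⟩
  · rw [Set.ofPred_forall]
    exact isClosed_iInter fun a => isClosed_le (by fun_prop) continuous_const
  · rw [Set.ofPred_forall]
    exact convex_iInter fun a => convex_halfSpace_le
      (IsLinearMap.mk (fun _ _ => inner_add_left _ _ _) fun _ _ => real_inner_smul_left _ _ _) 1
  · exact ⟨0, mem_interior_iff_mem_nhds.mpr
      (Filter.mem_of_superset (Metric.closedBall_mem_nhds 0 one_pos) hball)⟩

/-- The sum of the simplex vertices selected by a word `f`, one from each of `k` blocks. -/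
noncomputable def wordVector {n k q : ℕ} (e : Fin k × Fin q ↪ Fin n) (f : Fin k → Fin q) :
    EuclideanSpace ℝ (Fin n) :=
  ∑ i, simplexVertex n (some (e (i, f i)))

section wordVector

variable {n k q : ℕ} (e : Fin k × Fin q ↪ Fin n)

theorem inner_wordVector_none (hn : 1 ≤ n) (f : Fin k → Fin q) :
    ⟪wordVector e f, simplexVertex n none⟫ = -(k / n : ℝ) := by
  rw [wordVector, sum_inner]
  simp_rw [inner_simplexVertex hn]
  simp [div_eq_mul_inv]

theorem le_inner_wordVector_some (hn : 1 ≤ n) (f : Fin k → Fin q) (j : Fin n) :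
    -(k / n : ℝ) ≤ ⟪wordVector e f, simplexVertex n (some j)⟫ := by
  rw [wordVector, sum_inner]
  simp_rw [inner_simplexVertex hn, Finset.sum_sub_distrib]
  have h : 0 ≤ ∑ i, if some (e (i, f i)) = some j then 1 + 1 / (n : ℝ) else 0 :=
    Finset.sum_nonneg fun i _ => by split_ifs <;> positivity
  simp only [Finset.sum_const, Finset.card_univ, Fintype.card_fin, nsmul_eq_mul, mul_one_div]
  linarith

theorem inner_wordVector_wordVector (hn : 1 ≤ n) (f g : Fin k → Fin q) :
    ⟪wordVector e f, wordVector e g⟫ =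
      (1 + 1 / n : ℝ) * (Finset.univ.filter fun i => f i = g i).card - k ^ 2 / n := by
  rw [wordVector, wordVector, sum_inner]
  simp_rw [inner_sum, inner_simplexVertex hn, Finset.sum_sub_distrib]
  have h : ∀ i j : Fin k, (some (e (i, f i)) = some (e (j, g j))) ↔ i = j ∧ f i = g i := by
    intro i j
    rw [Option.some.injEq, e.injective.eq_iff, Prod.mk.injEq]
    constructor
    · rintro ⟨rfl, h⟩
      exact ⟨rfl, h⟩
    · rintro ⟨rfl, h⟩
      exact ⟨rfl, h⟩
  simp_rw [h, ite_and, Finset.sum_ite_eq, Finset.mem_univ, if_true, ← Finset.sum_filter]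
  simp only [Finset.sum_const, Finset.card_univ, Fintype.card_fin, nsmul_eq_mul]
  ring

/-- The outward normal that a word contributes to the body. -/
noncomputable def wordNormal (f : Fin k → Fin q) : EuclideanSpace ℝ (Fin n) :=
  (1 / 2 : ℝ) • (simplexVertex n none - (√k)⁻¹ • wordVector e f)

/-- The direction in which the normal contributed by a word is the only restrictive one. -/
noncomputable def wordDirection (f : Fin k → Fin q) : EuclideanSpace ℝ (Fin n) :=
  -((1 / 2 : ℝ) • simplexVertex n none + (√k)⁻¹ • wordVector e f)

theorem inner_none_none (hn : 1 ≤ n) : ⟪simplexVertex n none, simplexVertex n none⟫ = (1 : ℝ) := by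
  rw [inner_simplexVertex hn]
  simp

theorem inner_wordDirection_wordNormal (hn : 1 ≤ n) (hk : 1 ≤ k) (f g : Fin k → Fin q) :
    ⟪wordDirection e f, wordNormal e g⟫ = (1 / 2 : ℝ) * (-1 / 2 + √k / (2 * n) - k / n +
      (1 + 1 / n) * (Finset.univ.filter fun i => f i = g i).card / k) := by
  have hn0 : (n : ℝ) ≠ 0 := by positivity
  have hr0 : √(k : ℝ) ≠ 0 := by positivity
  have hk2 : (k : ℝ) = √k ^ 2 := (Real.sq_sqrt (by positivity)).symm
  simp only [wordDirection, wordNormal, inner_neg_left, inner_add_left, inner_sub_right,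
    real_inner_smul_left, real_inner_smul_right, inner_none_none hn,
    inner_wordVector_wordVector e hn, inner_wordVector_none e hn,
    real_inner_comm (wordVector e g) (simplexVertex n none)]
  set r := √(k : ℝ)
  rw [hk2]
  field_simp
  ring

theorem norm_wordNormal_le (hn : 1 ≤ n) (hk : 1 ≤ k) (f : Fin k → Fin q) :
    ‖wordNormal e f‖ ≤ 1 := by
  have hn1 : (1 : ℝ) ≤ n := by exact_mod_cast hn
  have hn0 : (n : ℝ) ≠ 0 := by positivity
  have hr0 : √(k : ℝ) ≠ 0 := by positivity
  have hk2 : (k : ℝ) = √k ^ 2 := (Real.sq_sqrt (by positivity)).symm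
  have h : ‖wordNormal e f‖ ^ 2 = 1 / 4 * (2 + 1 / n + (2 * √k - √k ^ 2) / n) := by
    rw [← real_inner_self_eq_norm_sq]
    simp only [wordNormal, inner_sub_left, inner_sub_right,
      real_inner_smul_left, real_inner_smul_right, inner_none_none hn,
      inner_wordVector_wordVector e hn, inner_wordVector_none e hn,
      real_inner_comm (wordVector e f) (simplexVertex n none)]
    simp only [Finset.filter_true, Finset.card_univ, Fintype.card_fin]
    set r := √(k : ℝ)
    rw [hk2]
    field_simp
    ring
  have h1 : 1 / (n : ℝ) ≤ 1 := (div_le_one (by positivity)).mpr hn1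
  have h2 : (2 * √(k : ℝ) - √k ^ 2) / n ≤ 1 / n := by
    gcongr
    nlinarith [sq_nonneg (√(k : ℝ) - 1)]
  nlinarith [norm_nonneg (wordNormal e f)]

theorem inner_wordDirection_simplexVertex_le (hn : 1 ≤ n) (hk : 1 ≤ k) (f : Fin k → Fin q)
    (a : Option (Fin n)) : ⟪wordDirection e f, simplexVertex n a⟫ ≤ 3 / 2 * (√k / n) := by
  have hn0 : (n : ℝ) ≠ 0 := by positivity
  have hr0 : √(k : ℝ) ≠ 0 := by positivity
  have hr1 : 1 ≤ √(k : ℝ) := Real.one_le_sqrt.mpr (by exact_mod_cast hk)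
  have hk2 : (k : ℝ) = √k ^ 2 := (Real.sq_sqrt (by positivity)).symm
  have hdiv : (√(k : ℝ))⁻¹ * (k / n) = √k / n := by
    set r := √(k : ℝ)
    rw [hk2]
    field_simp
  have h1n : 1 / (n : ℝ) ≤ √k / n := by gcongr
  simp only [wordDirection, inner_neg_left, inner_add_left, real_inner_smul_left]
  cases a with
  | none =>
    rw [inner_none_none hn, inner_wordVector_none e hn, mul_neg, hdiv]
    have : 0 ≤ √(k : ℝ) / n := by positivity
    linarith
  | some j =>
    rw [inner_simplexVertex hn]
    have h := mul_le_mul_of_nonneg_left (le_inner_wordVector_some e hn f j)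
      (inv_nonneg.mpr (Real.sqrt_nonneg (k : ℝ)))
    rw [mul_neg, hdiv] at h
    simp only [reduceCtorEq, if_false]
    linarith

end wordVector

/-- A body in John's position all of whose `R`-approximating polytopes have many facets, with the
bound expressed through a code of `q`-ary words of length `k`. -/
theorem exists_johnPosition_pow_le_card_facets {n k q : ℕ} {R : ℝ}
    (hn : 1 ≤ n) (hk : 1 ≤ k) (hq : 16 ≤ q)
    (hkq : k * q ≤ n) (hR0 : 0 < R) (hkn : 4 * k ≤ n) (hkR : 200 * (k * R ^ 2) ≤ (n : ℝ) ^ 2)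
    (hRn : 9 / 2 * R ≤ n) :
    ∃ K : Set (EuclideanSpace ℝ (Fin n)), IsConvexBody K ∧ InJohnPosition K ∧
      ∀ (m : ℕ) (w : Fin m → EuclideanSpace ℝ (Fin n)),
        K ⊆ {x | ∀ l, ⟪x, w l⟫ ≤ 1} →
        {x : EuclideanSpace ℝ (Fin n) | ∀ l, ⟪x, w l⟫ ≤ 1} ⊆ R • K →
        n ≤ m ∧ q ^ k ≤ m ^ 8 := by
  have hn0 : (0 : ℝ) < n := by exact_mod_cast hn
  have hn1 : (1 : ℝ) ≤ n := by exact_mod_cast hn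
  have hk1 : (1 : ℝ) ≤ k := by exact_mod_cast hk
  obtain ⟨F, hF, hFcard⟩ := exists_code hk hq
  obtain ⟨e⟩ : Nonempty (Fin k × Fin q ↪ Fin n) :=
    Function.Embedding.nonempty_of_card_le (by simpa using hkq)
  set K : Set (EuclideanSpace ℝ (Fin n)) :=
    {z | (∀ a, ⟪z, simplexVertex n a⟫ ≤ 1) ∧ ∀ f ∈ F, ⟪z, wordNormal e f⟫ ≤ 1} with hKdef
  have hbdd : Bornology.IsBounded K :=
    isBounded_of_inner_simplexVertex_le hn fun x hx a => hx.1 a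
  have hle : ∀ z v : EuclideanSpace ℝ (Fin n), ‖z‖ ≤ 1 → ‖v‖ ≤ 1 → ⟪z, v⟫ ≤ 1 := fun z v hz hv =>
    (real_inner_le_norm z v).trans (mul_le_one₀ hz (norm_nonneg v) hv)
  have hball : Metric.closedBall 0 1 ⊆ K := by
    intro z hz
    rw [mem_closedBall_zero_iff] at hz
    exact ⟨fun a => hle z _ hz (norm_simplexVertex hn a).le,
      fun f _ => hle z _ hz (norm_wordNormal_le e hn hk f)⟩
  refine ⟨K, ?_, ?_, ?_⟩
  · have hKeq : K = {z | ∀ b : Option (Fin n) ⊕ F,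
        ⟪z, Sum.elim (simplexVertex n) (fun f => wordNormal e f.1) b⟫ ≤ 1} := by
      ext z
      simp [hKdef, Sum.forall]
    rw [hKeq] at hbdd hball ⊢
    exact isConvexBody_of_inner_le _ hbdd hball
  · refine inJohnPosition_of_decomposition (simplexVertex n) (fun _ => (1 + 1 / n : ℝ)⁻¹)
      (fun _ => by positivity) (norm_simplexVertex hn) ?_ (fun x => ?_) hball fun x hx => hx.1
    · rw [← Finset.smul_sum, sum_simplexVertex hn, smul_zero]
    · rw [← Finset.mul_sum, sum_inner_simplexVertex_sq hn, inv_mul_cancel_left₀ (by positivity)]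
  intro m w hKP hPK
  have hnm : n ≤ m := le_card_facets_of_isBounded w ((hbdd.smul₀ R).subset hPK)
  refine ⟨hnm, ?_⟩
  have hkn' : (k : ℝ) / n ≤ 1 / 4 := by
    rw [div_le_iff₀ hn0]
    have : (4 : ℝ) * k ≤ n := by exact_mod_cast hkn
    linarith
  have hrk : √(k : ℝ) ≤ k := Real.sqrt_le_iff.mpr ⟨by positivity, by nlinarith⟩
  have hrn : √(k : ℝ) / (2 * n) ≤ (k : ℝ) / n / 2 := by
    rw [div_div, mul_comm (n : ℝ) 2]
    gcongr
  have hself : ∀ f : Fin k → Fin q, ⟪wordDirection e f, wordNormal e f⟫ =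
      (1 / 2 : ℝ) * (1 / 2 + √k / (2 * n) - k / n + 1 / n) := by
    intro f
    rw [inner_wordDirection_wordNormal e hn hk]
    simp only [Finset.filter_true, Finset.card_univ, Fintype.card_fin]
    field_simp
    ring
  have h1n : 1 / (n : ℝ) ≤ k / n := by gcongr
  have h1n0 : 0 < 1 / (n : ℝ) := by positivity
  have hcard := card_le_mul_card_facets (simplexVertex n) F
    (fun f => (9 * R) • wordDirection e f) (wordNormal e) hR0.le (B := 9 / 2 * R) (by positivity)
    (fun f _ a => ?_) (fun f _ => ?_) (fun f _ => ?_) (fun f hf g hg hfg => ?_) w hKP hPK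
  · have h1 : (F.card : ℝ) ^ 4 ≤ (m : ℝ) ^ 8 := by
      have hmn : (n : ℝ) ≤ m := by exact_mod_cast hnm
      have h2 : (F.card : ℝ) ≤ m * m :=
        hcard.trans (mul_le_mul_of_nonneg_left (hRn.trans hmn) (Nat.cast_nonneg m))
      calc (F.card : ℝ) ^ 4 ≤ (m * m : ℝ) ^ 4 := by gcongr
        _ = (m : ℝ) ^ 8 := by ring
    exact hFcard.trans (by exact_mod_cast h1)
  · rw [real_inner_smul_left]
    have h1 := mul_le_mul_of_nonneg_left (inner_wordDirection_simplexVertex_le e hn hk f a)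
      (show 0 ≤ 9 * R by positivity)
    refine h1.trans ?_
    have h2 : 27 / 2 * (√(k : ℝ) * R) ≤ n := by
      refine abs_le_of_sq_le_sq' ?_ hn0.le |>.2
      have : (√(k : ℝ)) ^ 2 = k := Real.sq_sqrt (by positivity)
      rw [mul_pow, mul_pow, this]
      nlinarith [show 0 ≤ k * R ^ 2 by positivity]
    have h3 : 9 * R * (3 / 2 * (√(k : ℝ) / n)) = 27 / 2 * (√(k : ℝ) * R) / n := by ring
    rw [h3, div_le_one hn0]
    exact h2
  · rw [real_inner_smul_left, hself]
    have : 0 ≤ √(k : ℝ) / (2 * n) := by positivity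
    nlinarith
  · rw [real_inner_smul_left, hself]
    have h4 : 1 / (n : ℝ) ≤ 1 := (div_le_one hn0).mpr hn1
    nlinarith
  · rw [real_inner_smul_left]
    refine mul_nonpos_of_nonneg_of_nonpos (by positivity) ?_
    rw [inner_wordDirection_wordNormal e hn hk]
    have hA : (2 : ℝ) * (Finset.univ.filter fun i => f i = g i).card ≤ k := by
      exact_mod_cast hF f hf g hg hfg
    have hAk : (1 + 1 / (n : ℝ)) * (Finset.univ.filter fun i => f i = g i).card / k ≤
        (1 + 1 / n) * (1 / 2) := by
      rw [mul_div_assoc]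
      refine mul_le_mul_of_nonneg_left ?_ (by positivity)
      rw [div_le_iff₀ (by positivity)]
      linarith
    linarith

theorem john_position_not_good_for_approximation :
    ∃ c₀ c₁ C : ℝ, 0 < c₀ ∧ 0 < c₁ ∧ 0 < C ∧
      ∀ᶠ n : ℕ in Filter.atTop, ∀ R : ℝ,
        c₀ * Real.sqrt n ≤ R → R ≤ c₁ * n →
          ∃ K : Set (EuclideanSpace ℝ (Fin n)), IsConvexBody K ∧ InJohnPosition K ∧
            ∀ (m : ℕ) (w : Fin m → EuclideanSpace ℝ (Fin n)),
              K ⊆ {x | ∀ l, ⟪x, w l⟫ ≤ 1} →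
              {x : EuclideanSpace ℝ (Fin n) | ∀ l, ⟪x, w l⟫ ≤ 1} ⊆ R • K →
              (m : ℝ) ≥ Real.exp (C * Real.log (R ^ 2 / n) * (n ^ 2 / R ^ 2)) := by
  refine ⟨1, 1 / 15, 1 / 3200, by norm_num, by norm_num, by norm_num, ?_⟩
  filter_upwards [Filter.eventually_ge_atTop 1] with n hn R hlo hhi
  have hn0 : (0 : ℝ) < n := by exact_mod_cast hn
  have hR0 : 0 < R := by
    have : 0 < √(n : ℝ) := Real.sqrt_pos.mpr hn0
    linarith
  have hnR : (n : ℝ) ≤ R ^ 2 := by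
    rw [one_mul] at hlo
    exact Real.sqrt_le_left hR0.le |>.mp hlo
  set t : ℝ := n ^ 2 / R ^ 2 with ht
  have htR : t * R ^ 2 = (n : ℝ) ^ 2 := div_mul_cancel₀ _ (by positivity)
  have ht200 : 1 ≤ t / 200 := by
    rw [le_div_iff₀ (by norm_num), ht, le_div_iff₀ (by positivity)]
    nlinarith
  have htn : t ≤ n := by
    rw [ht, div_le_iff₀ (by positivity)]
    nlinarith
  set k := ⌊t / 200⌋₊
  have hk : 1 ≤ k := Nat.one_le_floor_iff _ |>.mpr ht200
  have hk1 : (1 : ℝ) ≤ k := by exact_mod_cast hk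
  have hkt : (k : ℝ) ≤ t / 200 := Nat.floor_le (by positivity)
  have htk : t / 400 ≤ k := by
    have := Nat.lt_floor_add_one (t / 200)
    linarith
  set q := n / k
  have hkq : k * q ≤ n := Nat.mul_div_le n k
  have hqR : 199 * (R ^ 2 / n) ≤ q := by
    have h1 : (n : ℝ) < k * (q + 1) := by exact_mod_cast Nat.lt_mul_div_succ n hk
    have h2 : (n : ℝ) < t / 200 * (q + 1) := h1.trans_le (by gcongr)
    have h3 : 200 * R ^ 2 ≤ n * ((q : ℝ) + 1) := by
      have h4 : n * (200 * R ^ 2) ≤ n * (n * ((q : ℝ) + 1)) := by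
        calc n * (200 * R ^ 2) ≤ t / 200 * (q + 1) * (200 * R ^ 2) := by gcongr
          _ = t * R ^ 2 * (q + 1) := by ring
          _ = n * (n * ((q : ℝ) + 1)) := by rw [htR]; ring
      exact le_of_mul_le_mul_left h4 hn0
    rw [← mul_div_assoc, div_le_iff₀ hn0]
    linarith
  have hRn1 : 1 ≤ R ^ 2 / n := (one_le_div hn0).mpr hnR
  have hq : 16 ≤ q := by
    have : (16 : ℝ) ≤ q := by linarith
    exact_mod_cast this
  have hkn : 4 * k ≤ n := by
    have : (4 : ℝ) * k ≤ n := by linarith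
    exact_mod_cast this
  obtain ⟨K, hconv, hjohn, hK⟩ := exists_johnPosition_pow_le_card_facets hn hk hq hkq hR0 hkn
    (by nlinarith [sq_nonneg R]) (by linarith)
  refine ⟨K, hconv, hjohn, fun m w hKP hPK => ?_⟩
  obtain ⟨hnm, hqm⟩ := hK m w hKP hPK
  have hm0 : (0 : ℝ) < m := hn0.trans_le (by exact_mod_cast hnm)
  rw [ge_iff_le, ← Real.le_log_iff_exp_le hm0]
  have hpow : (R ^ 2 / n) ^ k ≤ (m : ℝ) ^ 8 := by
    calc (R ^ 2 / n) ^ k ≤ (q : ℝ) ^ k := by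
          gcongr
          linarith
      _ ≤ (m : ℝ) ^ 8 := by exact_mod_cast hqm
  have hlog := Real.log_le_log (by positivity) hpow
  rw [Real.log_pow, Real.log_pow] at hlog
  have hmul := mul_le_mul_of_nonneg_right htk (Real.log_nonneg hRn1)
  push_cast at hlog
  linarith
end

section
/- Let (R_n) be a positive increasing sequence with R_n → +∞ and R_n/n → 0. Then for every constant k > 0 and every sufficiently large n there exists a convex body K ⊂ ℝⁿ in John's position such that no polytope P of the form P = {x ∈ ℝⁿ : ⟨x, w_l⟩ ≤ 1 for l = 1, …, m} with m ≤ n^k satisfies K ⊆ P ⊆ R_n·K. -/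
open MeasureTheory RealInnerProductSpace Pointwise

lemma LinearMap.det_adjoint_real {E : Type*} [NormedAddCommGroup E] [InnerProductSpace ℝ E]
    [FiniteDimensional ℝ E] (A : E →ₗ[ℝ] E) : A.adjoint.det = A.det := by
  let b := stdOrthonormalBasis ℝ E
  rw [← LinearMap.det_toMatrix b.toBasis, ← LinearMap.det_toMatrix b.toBasis A,
    LinearMap.toMatrix_adjoint, Matrix.det_conjTranspose, star_trivial]

/-- A finite family of unit vectors satisfying John's condition with equal weights `c`. -/
structure IsJohnFamily {n : ℕ} {ι : Type*} [Fintype ι] (u : ι → EuclideanSpace ℝ (Fin n))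
    (c : ℝ) : Prop where
  nonneg : 0 ≤ c
  norm_eq_one : ∀ i, ‖u i‖ = 1
  sum_inner : ∀ y, ∑ i, ⟪u i, y⟫ = 0
  sum_inner_sq : ∀ y, c * ∑ i, ⟪u i, y⟫ ^ 2 = ‖y‖ ^ 2

namespace IsJohnFamily

variable {n : ℕ} {ι : Type*} [Fintype ι] {u : ι → EuclideanSpace ℝ (Fin n)} {c : ℝ}

lemma mul_card (h : IsJohnFamily u c) : c * Fintype.card ι = n := by
  let b := EuclideanSpace.basisFun (Fin n) ℝ
  have h1 : ∑ j, c * ∑ i, ⟪u i, b j⟫ ^ 2 = n := by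
    simp [h.sum_inner_sq]
  rw [← Finset.mul_sum, Finset.sum_comm] at h1
  simpa [b.sum_sq_inner_left, h.norm_eq_one] using h1

lemma norm_le (h : IsJohnFamily u c) {x : EuclideanSpace ℝ (Fin n)}
    (hx : ∀ i, ⟪u i, x⟫ ≤ 1) : ‖x‖ ≤ n := by
  have h1 : 0 ≤ c * ∑ i, (1 - ⟪u i, x⟫) * (⟪u i, x⟫ + ‖x‖) := by
    refine mul_nonneg h.nonneg (Finset.sum_nonneg fun i _ => mul_nonneg ?_ ?_)
    · linarith [hx i]
    · have := neg_le_of_abs_le (abs_real_inner_le_norm (u i) x)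
      rw [h.norm_eq_one] at this
      linarith
  have h2 : c * ∑ i, (1 - ⟪u i, x⟫) * (⟪u i, x⟫ + ‖x‖) = n * ‖x‖ - ‖x‖ ^ 2 := by
    have h3 : ∀ i, (1 - ⟪u i, x⟫) * (⟪u i, x⟫ + ‖x‖)
        = (1 - ‖x‖) * ⟪u i, x⟫ + ‖x‖ - ⟪u i, x⟫ ^ 2 := fun i => by ring
    simp_rw [h3, Finset.sum_sub_distrib, Finset.sum_add_distrib, ← Finset.mul_sum, h.sum_inner]
    rw [mul_sub, h.sum_inner_sq, ← h.mul_card]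
    simp
    ring
  rw [h2] at h1
  rcases (norm_nonneg x).eq_or_lt with h0 | h0
  · rw [← h0]; positivity
  · nlinarith

lemma abs_det_le_one (h : IsJohnFamily u c)
    (A : EuclideanSpace ℝ (Fin n) →ₗ[ℝ] EuclideanSpace ℝ (Fin n)) (a : EuclideanSpace ℝ (Fin n))
    (hA : ∀ i, ∀ x, ‖x‖ ≤ 1 → ⟪u i, A x + a⟫ ≤ 1) : |A.det| ≤ 1 := by
  have hn : Module.finrank ℝ (EuclideanSpace ℝ (Fin n)) = n := by simp
  have hpos := A.isPositive_self_comp_adjoint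
  have hS := hpos.isSymmetric
  set μ := hS.eigenvalues hn with hμ
  set e := hS.eigenvectorBasis hn with he
  have hμ0 : ∀ j, 0 ≤ μ j := hpos.nonneg_eigenvalues hn
  have hdet : |A.det| = ∏ j, √(μ j) := by
    have h1 := hS.det_eq_prod_eigenvalues hn
    rw [LinearMap.det_comp, LinearMap.det_adjoint_real] at h1
    rw [← Real.sqrt_sq_eq_abs, ← Real.sqrt_prod _ (fun j _ => hμ0 j)]
    congr 1
    simpa [sq] using h1
  have hadj : ∀ i, ‖A.adjoint (u i)‖ ≤ 1 - ⟪u i, a⟫ := by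
    intro i
    rcases (norm_nonneg (A.adjoint (u i))).eq_or_lt with h0 | h0
    · have := hA i 0 (by simp)
      simp at this
      linarith
    · have := hA i (‖A.adjoint (u i)‖⁻¹ • A.adjoint (u i)) (by
        rw [norm_smul, norm_inv, norm_norm, inv_mul_cancel₀ h0.ne'])
      rw [inner_add_right, ← LinearMap.adjoint_inner_left, inner_smul_right,
        real_inner_self_eq_norm_sq, sq, inv_mul_cancel_left₀ h0.ne'] at this
      linarith
  have hnorm : ∀ i, ‖A.adjoint (u i)‖ ^ 2 = ∑ j, μ j * ⟪u i, e j⟫ ^ 2 := by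
    intro i
    rw [← real_inner_self_eq_norm_sq, LinearMap.adjoint_inner_left, ← e.sum_inner_mul_inner]
    refine Finset.sum_congr rfl fun j _ => ?_
    have : ⟪e j, A (A.adjoint (u i))⟫ = μ j * ⟪e j, u i⟫ := by
      have h1 := hS (e j) (u i)
      rw [hS.apply_eigenvectorBasis hn j] at h1
      simpa [inner_smul_left] using h1.symm
    rw [this, real_inner_comm (e j)]
    ring
  have hge : ∀ i, ∑ j, √(μ j) * ⟪u i, e j⟫ ^ 2 ≤ ‖A.adjoint (u i)‖ := by
    intro i
    refine le_of_sq_le_sq ?_ (norm_nonneg _)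
    have h1 := Finset.sum_mul_sq_le_sq_mul_sq Finset.univ
      (fun j => √(μ j) * ⟪u i, e j⟫) (fun j => ⟪u i, e j⟫)
    have h2 : ∑ j, ⟪u i, e j⟫ ^ 2 = 1 := by
      rw [e.sum_sq_inner_left, h.norm_eq_one, one_pow]
    rw [h2, mul_one] at h1
    rw [hnorm]
    convert h1 using 2
    · exact Finset.sum_congr rfl fun j _ => by ring
    · rw [mul_pow, Real.sq_sqrt (hμ0 _)]
  have htr : ∑ j, √(μ j) ≤ n := by
    calc ∑ j, √(μ j) = ∑ j, √(μ j) * (c * ∑ i, ⟪u i, e j⟫ ^ 2) := by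
          simp [h.sum_inner_sq]
      _ = c * ∑ i, ∑ j, √(μ j) * ⟪u i, e j⟫ ^ 2 := by
          simp_rw [Finset.mul_sum]
          rw [Finset.sum_comm]
          exact Finset.sum_congr rfl fun i _ => Finset.sum_congr rfl fun j _ => by ring
      _ ≤ c * ∑ i, (1 - ⟪u i, a⟫) :=
          mul_le_mul_of_nonneg_left
            (Finset.sum_le_sum fun i _ => (hge i).trans (hadj i)) h.nonneg
      _ = n := by simp [h.sum_inner, h.mul_card]
  calc |A.det| = ∏ j, √(μ j) := hdet
    _ ≤ ∏ j, Real.exp (√(μ j) - 1) :=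
        Finset.prod_le_prod (fun j _ => Real.sqrt_nonneg _)
          fun j _ => by linarith [Real.add_one_le_exp (√(μ j) - 1)]
    _ = Real.exp (∑ j, √(μ j) - n) := by simp [← Real.exp_sum]
    _ ≤ 1 := Real.exp_le_one_iff.2 (by linarith)

lemma inJohnPosition (h : IsJohnFamily u c) {K : Set (EuclideanSpace ℝ (Fin n))}
    (hB : Metric.closedBall 0 1 ⊆ K) (hK : ∀ x ∈ K, ∀ i, ⟪u i, x⟫ ≤ 1) : InJohnPosition K := by
  refine ⟨hB, ?_⟩
  rintro _ ⟨T, rfl⟩ hE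
  have hT : ∀ x, T x = T.linear x + T 0 := fun x => by
    simpa using T.map_vadd 0 x
  have hdet : |LinearMap.det (T.linear : EuclideanSpace ℝ (Fin n) →ₗ[ℝ] _)| ≤ 1 := by
    refine h.abs_det_le_one _ (T 0) fun i x hx => ?_
    have := hK (T x) (hE ⟨x, by simpa using hx, rfl⟩) i
    rwa [hT] at this
  have him : T '' Metric.closedBall 0 1 = (fun y => y + T 0) ''
      ((T.linear : EuclideanSpace ℝ (Fin n) →ₗ[ℝ] _) '' Metric.closedBall 0 1) := by
    rw [Set.image_image]
    exact Set.image_congr fun x _ => hT x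
  rw [him, Set.image_add_right, measure_preimage_add_right, Measure.addHaar_image_linearMap]
  exact mul_le_of_le_one_left' (by simpa using ENNReal.ofReal_le_ofReal hdet)

end IsJohnFamily

/-- The orthogonal projections of the standard basis of `ℝⁿ⁺¹` onto the hyperplane of vectors with
vanishing coordinate sum, in suitable coordinates of that hyperplane. -/
noncomputable def simplexVec (n : ℕ) : Option (Fin n) → EuclideanSpace ℝ (Fin n)
  | none => WithLp.toLp 2 fun _ => -(√(n + 1))⁻¹
  | some i => EuclideanSpace.single i 1 - WithLp.toLp 2 fun _ => (1 - (√(n + 1))⁻¹) / n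

section simplexVec

variable {n : ℕ}

lemma simplexVec_none_inner (y : EuclideanSpace ℝ (Fin n)) :
    ⟪simplexVec n none, y⟫ = -(√(n + 1))⁻¹ * ∑ i, y i := by
  simp [simplexVec, PiLp.inner_apply, ← Finset.mul_sum, mul_comm]

lemma simplexVec_some_inner (i : Fin n) (y : EuclideanSpace ℝ (Fin n)) :
    ⟪simplexVec n (some i), y⟫ = y i - (1 - (√(n + 1))⁻¹) / n * ∑ i, y i := by
  rw [simplexVec, inner_sub_left, EuclideanSpace.inner_single_left]
  simp [PiLp.inner_apply, ← Finset.mul_sum, mul_comm]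

lemma inv_sqrt_succ_sq (n : ℕ) : ((√((n : ℝ) + 1))⁻¹) ^ 2 = 1 / (n + 1) := by
  rw [inv_pow, Real.sq_sqrt (by positivity), one_div]

lemma sum_simplexVec_inner (hn : n ≠ 0) (y : EuclideanSpace ℝ (Fin n)) :
    ∑ o, ⟪simplexVec n o, y⟫ = 0 := by
  have hn' : (n : ℝ) ≠ 0 := by exact_mod_cast hn
  rw [Fintype.sum_option]
  simp_rw [simplexVec_none_inner, simplexVec_some_inner, Finset.sum_sub_distrib]
  simp
  field_simp
  ring

lemma sum_simplexVec_inner_sq (hn : n ≠ 0) (y : EuclideanSpace ℝ (Fin n)) :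
    ∑ o, ⟪simplexVec n o, y⟫ ^ 2 = ‖y‖ ^ 2 := by
  have hn' : (n : ℝ) ≠ 0 := by exact_mod_cast hn
  have hr := inv_sqrt_succ_sq n
  rw [Fintype.sum_option, EuclideanSpace.norm_sq_eq]
  simp_rw [simplexVec_none_inner, simplexVec_some_inner, sub_sq, Finset.sum_add_distrib,
    Finset.sum_sub_distrib, ← Finset.sum_mul, ← Finset.mul_sum]
  simp only [Real.norm_eq_abs, sq_abs, Finset.sum_const, Finset.card_univ, Fintype.card_fin,
    nsmul_eq_mul]
  generalize (√((n : ℝ) + 1))⁻¹ = r at *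
  have hn1 : (n : ℝ) + 1 ≠ 0 := by positivity
  have hr' : r ^ 2 * (n + 1) = 1 := by rw [hr]; field_simp
  field_simp
  linear_combination (∑ i, y i) ^ 2 * hr'

lemma inner_simplexVec (hn : n ≠ 0) (o o' : Option (Fin n)) :
    ⟪simplexVec n o, simplexVec n o'⟫ = (if o = o' then 1 else 0) - 1 / ((n : ℝ) + 1) := by
  have hn' : (n : ℝ) ≠ 0 := by exact_mod_cast hn
  have hr := inv_sqrt_succ_sq n
  have hn1 : (n : ℝ) + 1 ≠ 0 := by positivity
  have hr' : (√((n : ℝ) + 1))⁻¹ ^ 2 * (n + 1) = 1 := by rw [hr]; field_simp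
  rcases o with _ | i <;> rcases o' with _ | j <;>
  simp only [simplexVec_none_inner, simplexVec_some_inner] <;>
  simp [simplexVec, Finset.sum_sub_distrib, -Real.sqrt_inv, eq_comm] <;>
  generalize (√((n : ℝ) + 1))⁻¹ = r at * <;>
  field_simp
  · linear_combination -hr' * n
  · linear_combination -hr'
  · linear_combination hr'
  · split_ifs <;> linear_combination -hr'

/-- The unit outer normals of a regular simplex with inscribed ball the unit ball. -/
noncomputable def simplexNormal (n : ℕ) (o : Option (Fin n)) : EuclideanSpace ℝ (Fin n) :=
  -√((n + 1) / n) • simplexVec n o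

lemma isJohnFamily_simplexNormal (hn : n ≠ 0) :
    IsJohnFamily (simplexNormal n) (n / (n + 1)) where
  nonneg := by positivity
  norm_eq_one o := by
    have hn' : (n : ℝ) ≠ 0 := by exact_mod_cast hn
    refine (sq_eq_sq₀ (norm_nonneg _) zero_le_one).1 ?_
    rw [simplexNormal, norm_smul, mul_pow, ← real_inner_self_eq_norm_sq (simplexVec n o),
      inner_simplexVec hn, norm_neg, Real.norm_eq_abs, sq_abs, Real.sq_sqrt (by positivity)]
    simp
    field_simp
    ring
  sum_inner y := by
    simp [simplexNormal, inner_smul_left, ← Finset.mul_sum, sum_simplexVec_inner hn]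
  sum_inner_sq y := by
    have hn' : (n : ℝ) ≠ 0 := by exact_mod_cast hn
    simp_rw [simplexNormal, inner_smul_left, mul_pow, ← Finset.mul_sum,
      sum_simplexVec_inner_sq hn]
    simp only [map_neg, conj_trivial, neg_sq]
    rw [Real.sq_sqrt (by positivity)]
    field_simp

/-- The linear combination of the vectors `simplexVec n o` with coefficients `g`. -/
noncomputable def simplexComb (g : Option (Fin n) → ℝ) : EuclideanSpace ℝ (Fin n) :=
  ∑ o, g o • simplexVec n o

lemma simplexComb_inner_simplexVec (hn : n ≠ 0) (g : Option (Fin n) → ℝ) (o : Option (Fin n)) :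
    ⟪simplexComb g, simplexVec n o⟫ = g o - (∑ o, g o) / (n + 1) := by
  simp_rw [simplexComb, sum_inner, real_inner_smul_left, inner_simplexVec hn, mul_sub,
    Finset.sum_sub_distrib, ← Finset.sum_mul]
  simp [div_eq_mul_inv]

lemma norm_simplexComb_sq_le (hn : n ≠ 0) (g : Option (Fin n) → ℝ) :
    ‖simplexComb g‖ ^ 2 ≤ ∑ o, g o ^ 2 := by
  have h : ‖simplexComb g‖ ^ 2 = ∑ o, g o ^ 2 - (∑ o, g o) ^ 2 / (n + 1) := by
    rw [← real_inner_self_eq_norm_sq]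
    nth_rw 2 [simplexComb]
    simp_rw [inner_sum, real_inner_smul_right, simplexComb_inner_simplexVec hn, mul_sub,
      Finset.sum_sub_distrib, ← Finset.sum_mul]
    congr 1
    · exact Finset.sum_congr rfl fun _ _ => by ring
    · ring
  rw [h]
  have : 0 ≤ (∑ o, g o) ^ 2 / ((n : ℝ) + 1) := by positivity
  linarith

end simplexVec

lemma card_filter_le_card_preimage_le {m n : ℕ} (H : Finset (Fin n)) (q : ℕ) :
    (Finset.univ.filter fun a : Fin m → Fin n =>
      q ≤ (Finset.univ.filter fun j => a j ∈ H).card).card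
      ≤ m.choose q * (H.card ^ q * n ^ (m - q)) := by
  classical
  have hsub : (Finset.univ.filter fun a : Fin m → Fin n =>
      q ≤ (Finset.univ.filter fun j => a j ∈ H).card) ⊆
      (Finset.univ.powersetCard q).biUnion fun J : Finset (Fin m) =>
        Fintype.piFinset fun j => if j ∈ J then H else Finset.univ := by
    intro a ha
    obtain ⟨J, hJ, hJq⟩ := Finset.exists_subset_card_eq (Finset.mem_filter.1 ha).2
    refine Finset.mem_biUnion.2 ⟨J, by simpa using hJq, Fintype.mem_piFinset.2 fun j => ?_⟩
    split_ifs with hj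
    · exact (Finset.mem_filter.1 (hJ hj)).2
    · exact Finset.mem_univ _
  refine (Finset.card_le_card hsub).trans (Finset.card_biUnion_le.trans ?_)
  refine (Finset.sum_le_card_nsmul _ _ (H.card ^ q * n ^ (m - q)) fun J hJ => ?_).trans (by simp)
  rw [Finset.mem_powersetCard_univ] at hJ
  rw [Fintype.card_piFinset]
  simp_rw [apply_ite Finset.card]
  rw [Finset.prod_ite]
  simp [Finset.filter_not, Finset.card_univ_sdiff, hJ]

lemma exists_forall_card_preimage_le {m n q M N : ℕ} (H : Fin N → Finset (Fin n))
    (hH : ∀ l, (H l).card ≤ M) (hq : q ≤ m) (hn : 0 < n) (hN : N * (m.choose q * M ^ q) < n ^ q) :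
    ∃ a : Fin m → Fin n, ∀ l, (Finset.univ.filter fun j => a j ∈ H l).card ≤ q := by
  classical
  by_contra! hcon
  have hcover : (Finset.univ : Finset (Fin m → Fin n)) ⊆
      Finset.univ.biUnion fun l : Fin N => Finset.univ.filter fun a : Fin m → Fin n =>
        q ≤ (Finset.univ.filter fun j => a j ∈ H l).card := by
    intro a _
    obtain ⟨l, hl⟩ := hcon a
    simpa using ⟨l, hl.le⟩
  have h1 : n ^ m ≤ N * (m.choose q * (M ^ q * n ^ (m - q))) := by
    calc n ^ m = (Finset.univ : Finset (Fin m → Fin n)).card := by simp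
      _ ≤ _ := (Finset.card_le_card hcover).trans Finset.card_biUnion_le
      _ ≤ ∑ _l : Fin N, m.choose q * (M ^ q * n ^ (m - q)) :=
          Finset.sum_le_sum fun l _ => (card_filter_le_card_preimage_le _ q).trans
            (by gcongr; exact hH l)
      _ = _ := by simp
  have h2 : n ^ m = n ^ q * n ^ (m - q) := by rw [← pow_add, Nat.add_sub_cancel' hq]
  have h3 : N * (m.choose q * (M ^ q * n ^ (m - q)))
      = N * (m.choose q * M ^ q) * n ^ (m - q) := by ring
  rw [h2, h3] at h1
  exact (Nat.le_of_mul_le_mul_right h1 (by positivity)).not_gt hN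

/-- The points `x` with `⟪z k, x⟫ ≤ 1` for all `k`. -/
def polarBody {n : ℕ} {κ : Type*} (z : κ → EuclideanSpace ℝ (Fin n)) :
    Set (EuclideanSpace ℝ (Fin n)) :=
  {x | ∀ k, ⟪z k, x⟫ ≤ 1}

section polarBody

variable {n : ℕ} {κ : Type*} {z : κ → EuclideanSpace ℝ (Fin n)}

lemma isClosed_polarBody : IsClosed (polarBody z) := by
  simp only [polarBody, Set.ofPred_forall]
  exact isClosed_iInter fun k => isClosed_le (by fun_prop) continuous_const

lemma convex_polarBody : Convex ℝ (polarBody z) := by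
  simp only [polarBody, Set.ofPred_forall]
  exact convex_iInter fun k => convex_halfSpace_le (innerSL ℝ (z k)).isLinear 1

lemma closedBall_subset_polarBody (hz : ∀ k, ‖z k‖ ≤ 1) :
    Metric.closedBall 0 1 ⊆ polarBody z := by
  intro x hx k
  rw [mem_closedBall_zero_iff] at hx
  exact (real_inner_le_norm _ _).trans (mul_le_one₀ (hz k) (norm_nonneg _) hx)

namespace IsJohnFamily

variable {ι : Type*} [Fintype ι] {u : ι → EuclideanSpace ℝ (Fin n)} {c : ℝ}

lemma isConvexBody_polarBody (h : IsJohnFamily u c) (hu : Set.range u ⊆ Set.range z)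
    (hz : ∀ k, ‖z k‖ ≤ 1) : IsConvexBody (polarBody z) := by
  refine ⟨?_, convex_polarBody, ?_⟩
  · refine Metric.isCompact_of_isClosed_isBounded isClosed_polarBody
      (Metric.isBounded_closedBall (x := 0) (r := n) |>.subset fun x hx => ?_)
    rw [mem_closedBall_zero_iff]
    refine h.norm_le fun i => ?_
    obtain ⟨k, hk⟩ := hu ⟨i, rfl⟩
    exact hk ▸ hx k
  · exact ⟨0, interior_mono (closedBall_subset_polarBody hz)
      (Metric.ball_subset_interior_closedBall (by simp))⟩

lemma inJohnPosition_polarBody (h : IsJohnFamily u c) (hu : Set.range u ⊆ Set.range z)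
    (hz : ∀ k, ‖z k‖ ≤ 1) : InJohnPosition (polarBody z) := by
  refine h.inJohnPosition (closedBall_subset_polarBody hz) fun x hx i => ?_
  obtain ⟨k, hk⟩ := hu ⟨i, rfl⟩
  exact hk ▸ hx k

lemma mem_convexHull_of_polarBody [Finite κ] [Nonempty ι] (h : IsJohnFamily u c)
    (hu : Set.range u ⊆ Set.range z) {w : EuclideanSpace ℝ (Fin n)}
    (hw : ∀ x ∈ polarBody z, ⟪x, w⟫ ≤ 1) : w ∈ convexHull ℝ (Set.range z) := by
  by_contra hcon
  obtain ⟨f, s, hfs, hsw⟩ := geometric_hahn_banach_closed_point (convex_convexHull ℝ _)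
    ((Set.finite_range z).isCompact_convexHull ℝ).isClosed hcon
  obtain ⟨x, rfl⟩ := (InnerProductSpace.toDual ℝ (EuclideanSpace ℝ (Fin n))).surjective f
  simp only [InnerProductSpace.toDual_apply_apply] at hfs hsw
  have hz : ∀ k, ⟪x, z k⟫ < s := fun k => hfs _ (subset_convexHull ℝ _ ⟨k, rfl⟩)
  have hs : 0 < s := by
    by_contra! hs
    have hneg : ∑ i, ⟪u i, x⟫ < 0 := by
      refine Finset.sum_neg (fun i _ => ?_) Finset.univ_nonempty
      obtain ⟨k, hk⟩ := hu ⟨i, rfl⟩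
      rw [← hk, real_inner_comm]
      exact (hz k).trans_le hs
    exact hneg.ne (h.sum_inner x)
  have h1 := hw (s⁻¹ • x) fun k => by
    rw [real_inner_smul_right, real_inner_comm, inv_mul_le_one₀ hs]
    exact (hz k).le
  rw [real_inner_smul_left, inv_mul_le_one₀ hs] at h1
  exact absurd h1 hsw.not_ge

end IsJohnFamily

end polarBody

section farPoint

variable {m n : ℕ}

/-- The midpoint of the vertex `n • simplexVec n none` of a regular simplex and the average of the
vertices selected by `a`. -/
noncomputable def farPoint (a : Fin m → Fin n) : EuclideanSpace ℝ (Fin n) :=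
  (n : ℝ) • ((1 / 2 : ℝ) • simplexVec n none +
    (1 / (2 * m) : ℝ) • ∑ j, simplexVec n (some (a j)))

open Classical in
/-- Coefficients of the vector cutting off `farPoint a`. -/
noncomputable def cutCoeff (a : Fin m → Fin n) : Option (Fin n) → ℝ
  | none => -1 / 2
  | some i => if i ∈ Set.range a then 1 else 0

/-- A vector of norm at most one whose half-space cuts off `farPoint a`. -/
noncomputable def cutVec (a : Fin m → Fin n) : EuclideanSpace ℝ (Fin n) :=
  ((m : ℝ) + 1)⁻¹ • simplexComb (cutCoeff a)

lemma simplexComb_inner_farPoint (hm : m ≠ 0) (hn : n ≠ 0) (g : Option (Fin n) → ℝ)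
    (a : Fin m → Fin n) :
    ⟪simplexComb g, farPoint a⟫
      = n * (g none / 2 + 1 / (2 * m) * ∑ j, g (some (a j)) - (∑ o, g o) / (n + 1)) := by
  have hm' : (m : ℝ) ≠ 0 := by exact_mod_cast hm
  simp_rw [farPoint, real_inner_smul_right, inner_add_right, real_inner_smul_right, inner_sum,
    simplexComb_inner_simplexVec hn, Finset.sum_sub_distrib, Finset.sum_const, Finset.card_univ,
    Fintype.card_fin, nsmul_eq_mul]
  field_simp
  ring

lemma simplexNormal_inner_farPoint_le (hm : m ≠ 0) (hn : n ≠ 0) (o : Option (Fin n))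
    (a : Fin m → Fin n) : ⟪simplexNormal n o, farPoint a⟫ ≤ 1 := by
  classical
  have hn' : (0 : ℝ) < n := by exact_mod_cast Nat.pos_of_ne_zero hn
  have h1 : simplexVec n o = simplexComb (Pi.single o 1) := by
    simp [simplexComb, Pi.single_apply, ite_smul]
  have hg : ∀ o', 0 ≤ (Pi.single o 1 : Option (Fin n) → ℝ) o' :=
    fun o' => (Pi.single_nonneg.2 zero_le_one : (0 : Option (Fin n) → ℝ) ≤ Pi.single o 1) o'
  have h2 : -(n / ((n : ℝ) + 1)) ≤ ⟪simplexVec n o, farPoint a⟫ := by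
    rw [h1, simplexComb_inner_farPoint hm hn, Finset.sum_pi_single']
    have h3 : 0 ≤ (Pi.single o 1 : Option (Fin n) → ℝ) none / 2 + 1 / (2 * m)
        * ∑ j, (Pi.single o 1 : Option (Fin n) → ℝ) (some (a j)) :=
      add_nonneg (div_nonneg (hg _) two_pos.le)
        (mul_nonneg (by positivity) (Finset.sum_nonneg fun j _ => hg _))
    have h4 := mul_nonneg hn'.le h3
    simp only [Finset.mem_univ, if_true]
    rw [mul_sub, mul_one_div]
    linarith
  have h3 : √(((n : ℝ) + 1) / n) ≤ (n + 1) / n := by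
    refine Real.sqrt_le_iff.2 ⟨by positivity, le_self_pow₀ ?_ two_ne_zero⟩
    rw [le_div_iff₀ hn']
    linarith
  rw [simplexNormal, real_inner_smul_left]
  calc -√(((n : ℝ) + 1) / n) * ⟪simplexVec n o, farPoint a⟫
      ≤ √(((n : ℝ) + 1) / n) * (n / (n + 1)) := by
        nlinarith [Real.sqrt_nonneg (((n : ℝ) + 1) / n)]
    _ ≤ (n + 1) / n * (n / (n + 1)) := by gcongr
    _ = 1 := by field_simp

open Classical in
lemma sum_cutCoeff_some (a : Fin m → Fin n) :
    ∑ i, cutCoeff a (some i) = (Finset.univ.image a).card := by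
  simp only [cutCoeff, Finset.sum_boole]
  congr 2
  ext
  simp

lemma sum_cutCoeff_some_le (a : Fin m → Fin n) : ∑ i, cutCoeff a (some i) ≤ m := by
  classical
  rw [sum_cutCoeff_some]
  exact_mod_cast Finset.card_image_le.trans (by simp)

lemma one_le_sum_cutCoeff_some (hm : m ≠ 0) (a : Fin m → Fin n) :
    1 ≤ ∑ i, cutCoeff a (some i) := by
  classical
  rw [sum_cutCoeff_some]
  have : NeZero m := ⟨hm⟩
  exact_mod_cast Finset.card_pos.2 (Finset.univ_nonempty.image a)

lemma norm_cutVec_le (hn : n ≠ 0) (a : Fin m → Fin n) : ‖cutVec a‖ ≤ 1 := by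
  have h1 : ‖simplexComb (cutCoeff a)‖ ^ 2 ≤ ((m : ℝ) + 1) ^ 2 := by
    refine (norm_simplexComb_sq_le hn _).trans ?_
    have h2 : ∀ i, cutCoeff a (some i) ^ 2 = cutCoeff a (some i) := fun i => by
      simp [cutCoeff]
    rw [Fintype.sum_option]
    simp_rw [h2]
    have h3 := sum_cutCoeff_some_le a
    have h4 : cutCoeff a none = -1 / 2 := rfl
    rw [h4]
    nlinarith [(Nat.cast_nonneg m : (0 : ℝ) ≤ m)]
  rw [cutVec, norm_smul, norm_inv, Real.norm_of_nonneg (by positivity),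
    inv_mul_le_one₀ (by positivity)]
  exact le_of_sq_le_sq h1 (by positivity)

lemma cutVec_inner_farPoint_le (hm : m ≠ 0) (hn : n ≠ 0) (b a : Fin m → Fin n) :
    ⟪cutVec b, farPoint a⟫
      ≤ n / (m + 1) * (-1 / 4 + 1 / (2 * m) * ∑ j, cutCoeff b (some (a j))) := by
  rw [cutVec, real_inner_smul_left, simplexComb_inner_farPoint hm hn, Fintype.sum_option]
  have h1 := one_le_sum_cutCoeff_some hm b
  have h2 : cutCoeff b none = -1 / 2 := rfl
  rw [h2, inv_mul_eq_div, mul_div_right_comm]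
  gcongr
  have : 0 ≤ (-1 / 2 + ∑ i, cutCoeff b (some i)) / ((n : ℝ) + 1) :=
    div_nonneg (by linarith) (by positivity)
  linarith

lemma le_cutVec_inner_farPoint_self (hm : m ≠ 0) (hn : 8 * m ≤ n) (a : Fin m → Fin n) :
    n / (8 * (m + 1)) ≤ ⟪cutVec a, farPoint a⟫ := by
  have hn0 : n ≠ 0 := by omega
  have hm' : (m : ℝ) ≠ 0 := by exact_mod_cast hm
  rw [cutVec, real_inner_smul_left, simplexComb_inner_farPoint hm hn0, Fintype.sum_option]
  have h1 := sum_cutCoeff_some_le a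
  have h2 : cutCoeff a none = -1 / 2 := rfl
  have h3 : ∀ j, cutCoeff a (some (a j)) = 1 := fun j => by simp [cutCoeff]
  have h4 : (-1 / 2 + ∑ i, cutCoeff a (some i)) / ((n : ℝ) + 1) ≤ 1 / 8 := by
    rw [div_le_iff₀ (by positivity)]
    have : (8 * m : ℝ) ≤ n := by exact_mod_cast hn
    linarith
  simp_rw [h3]
  rw [h2, inv_mul_eq_div, mul_div_right_comm, mul_comm (8 : ℝ), ← div_div, div_eq_mul_one_div _ 8]
  gcongr
  have h5 : 1 / (2 * (m : ℝ)) * ∑ _j : Fin m, (1 : ℝ) = 1 / 2 := by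
    simp
    field_simp
  rw [h5]
  linarith

/-- A member of the convex hull of the normals, as a functional on the far points, is bounded by an
affine function of `∑ j, f (a j)`. -/
lemma exists_coeff_of_mem_convexHull (hm : m ≠ 0) (hn : n ≠ 0) {w : EuclideanSpace ℝ (Fin n)}
    (hw : w ∈ convexHull ℝ (Set.range
      (Sum.elim (simplexNormal n) (cutVec : (Fin m → Fin n) → EuclideanSpace ℝ (Fin n))))) :
    ∃ (f : Fin n → ℝ) (θ : ℝ), (∀ i, f i ≤ θ) ∧ (∀ i, 0 ≤ f i) ∧
      0 ≤ θ ∧ ∑ i, f i ≤ m * θ ∧ ∀ a : Fin m → Fin n,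
        ⟪w, farPoint a⟫ ≤ 1 + n / (m + 1) * (-θ / 4 + 1 / (2 * m) * ∑ j, f (a j)) := by
  refine convexHull_min (t := {w | ∃ (f : Fin n → ℝ) (θ : ℝ), (∀ i, f i ≤ θ) ∧ (∀ i, 0 ≤ f i) ∧
      0 ≤ θ ∧ ∑ i, f i ≤ m * θ ∧ ∀ a : Fin m → Fin n, ⟪w, farPoint a⟫
        ≤ 1 + n / (m + 1) * (-θ / 4 + 1 / (2 * m) * ∑ j, f (a j))}) ?_ ?_ hw
  · rintro _ ⟨o | b, rfl⟩
    · exact ⟨0, 0, by simp, by simp, le_rfl, by simp, fun a => by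
        simpa using simplexNormal_inner_farPoint_le hm hn o a⟩
    · refine ⟨fun i => cutCoeff b (some i), 1, fun i => ?_, fun i => ?_, zero_le_one, ?_,
        fun a => ?_⟩
      · simp only [cutCoeff]; split_ifs <;> norm_num
      · simp only [cutCoeff]; split_ifs <;> norm_num
      · simpa using sum_cutCoeff_some_le b
      · have := cutVec_inner_farPoint_le hm hn b a
        simp only [Sum.elim_inr]
        linarith
  · rintro w₁ ⟨f₁, θ₁, h1, h2, h3, h4, h5⟩ w₂ ⟨f₂, θ₂, k1, k2, k3, k4, k5⟩ s t hs ht hst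
    refine ⟨fun i => s * f₁ i + t * f₂ i, s * θ₁ + t * θ₂, fun i => ?_, fun i => ?_, ?_, ?_,
      fun a => ?_⟩
    · exact add_le_add (mul_le_mul_of_nonneg_left (h1 i) hs) (mul_le_mul_of_nonneg_left (k1 i) ht)
    · have := h2 i; have := k2 i; positivity
    · positivity
    · rw [Finset.sum_add_distrib, ← Finset.mul_sum, ← Finset.mul_sum]
      linarith [mul_le_mul_of_nonneg_left h4 hs, mul_le_mul_of_nonneg_left k4 ht]
    · rw [Finset.sum_add_distrib, ← Finset.mul_sum, ← Finset.mul_sum, inner_add_left,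
        real_inner_smul_left, real_inner_smul_left]
      have e1 := mul_le_mul_of_nonneg_left (h5 a) hs
      have e2 := mul_le_mul_of_nonneg_left (k5 a) ht
      refine (add_le_add e1 e2).trans (le_of_eq ?_)
      linear_combination hst

lemma exists_finset_of_mem_convexHull (hm : m ≠ 0) (hn : n ≠ 0) {w : EuclideanSpace ℝ (Fin n)}
    (hw : w ∈ convexHull ℝ (Set.range
      (Sum.elim (simplexNormal n) (cutVec : (Fin m → Fin n) → EuclideanSpace ℝ (Fin n))))) :
    ∃ H : Finset (Fin n), H.card ≤ 4 * m ∧ ∀ a : Fin m → Fin n,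
      4 * (Finset.univ.filter fun j => a j ∈ H).card ≤ m → ⟪w, farPoint a⟫ ≤ 1 := by
  have hm' : (0 : ℝ) < m := by exact_mod_cast Nat.pos_of_ne_zero hm
  obtain ⟨f, θ, hfθ, hf0, hθ, hsum, hw⟩ := exists_coeff_of_mem_convexHull hm hn hw
  refine ⟨Finset.univ.filter fun i => θ / 4 < f i, ?_, fun a ha => ?_⟩
  · rcases hθ.eq_or_lt with rfl | hθ
    · rw [Finset.filter_false_of_mem fun i _ => by simpa using hfθ i]
      simp
    · have h1 := Finset.card_nsmul_le_sum (Finset.univ.filter fun i => θ / 4 < f i) f (θ / 4)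
        fun i hi => (Finset.mem_filter.1 hi).2.le
      have h2 := Finset.sum_le_univ_sum_of_nonneg hf0
        (s := Finset.univ.filter fun i => θ / 4 < f i)
      rw [nsmul_eq_mul] at h1
      have h3 : ((Finset.univ.filter fun i => θ / 4 < f i).card : ℝ) * θ ≤ (4 * m) * θ := by
        linarith
      exact_mod_cast le_of_mul_le_mul_right h3 hθ
  · refine (hw a).trans ?_
    have h1 : ∑ j, f (a j) ≤ ∑ j, (θ / 4 +
        θ * if a j ∈ (Finset.univ.filter fun i => θ / 4 < f i) then 1 else 0) := by
      refine Finset.sum_le_sum fun j _ => ?_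
      split_ifs with hj
      · linarith [hfθ (a j)]
      · simp only [Finset.mem_filter, Finset.mem_univ, true_and, not_lt] at hj
        linarith
    rw [Finset.sum_add_distrib, ← Finset.mul_sum, Finset.sum_boole, Finset.sum_const,
      Finset.card_univ, Fintype.card_fin, nsmul_eq_mul] at h1
    have h2 : (4 * (Finset.univ.filter fun j =>
        a j ∈ (Finset.univ.filter fun i => θ / 4 < f i)).card : ℝ) ≤ m := by exact_mod_cast ha
    have h3 : 1 / (2 * m) * ∑ j, f (a j) ≤ θ / 4 := by
      rw [one_div, inv_mul_le_iff₀ (by positivity)]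
      nlinarith [mul_le_mul_of_nonneg_left h2 hθ]
    have h4 : n / ((m : ℝ) + 1) * (-θ / 4 + 1 / (2 * m) * ∑ j, f (a j)) ≤ 0 :=
      mul_nonpos_of_nonneg_of_nonpos (by positivity) (by linarith)
    linarith

end farPoint

lemma no_approximation_polarBody {m n q N : ℕ} (hmq : m = 4 * q) (hq : q ≠ 0) (hn : 8 * m ≤ n)
    (hN : N * (m.choose q * (4 * m) ^ q) < n ^ q) {r : ℝ} (hr : 0 ≤ r)
    (hrn : r < n / (8 * (m + 1))) (w : Fin N → EuclideanSpace ℝ (Fin n))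
    (hKP : polarBody (Sum.elim (simplexNormal n)
      (cutVec : (Fin m → Fin n) → EuclideanSpace ℝ (Fin n))) ⊆ {x | ∀ l, ⟪x, w l⟫ ≤ 1}) :
    ¬ {x : EuclideanSpace ℝ (Fin n) | ∀ l, ⟪x, w l⟫ ≤ 1} ⊆
      r • polarBody (Sum.elim (simplexNormal n)
        (cutVec : (Fin m → Fin n) → EuclideanSpace ℝ (Fin n))) := by
  intro hPK
  have hm : m ≠ 0 := by omega
  have hn0 : n ≠ 0 := by omega
  have hu : Set.range (simplexNormal n) ⊆ Set.range (Sum.elim (simplexNormal n)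
      (cutVec : (Fin m → Fin n) → EuclideanSpace ℝ (Fin n))) := by
    rw [Set.Sum.elim_range]
    exact Set.subset_union_left
  have hw : ∀ l, w l ∈ convexHull ℝ (Set.range (Sum.elim (simplexNormal n)
      (cutVec : (Fin m → Fin n) → EuclideanSpace ℝ (Fin n)))) := fun l =>
    (isJohnFamily_simplexNormal hn0).mem_convexHull_of_polarBody hu fun x hx => hKP hx l
  choose H hH hHw using fun l => exists_finset_of_mem_convexHull hm hn0 (hw l)
  obtain ⟨a, ha⟩ := exists_forall_card_preimage_le H hH (by omega : q ≤ m) (by omega) hN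
  obtain ⟨y, hy, hya⟩ := hPK (show farPoint a ∈ _ from fun l => by
    rw [real_inner_comm]
    exact hHw l a (by have := ha l; omega))
  have h1 := le_cutVec_inner_farPoint_self hm hn a
  have h2 : ⟪cutVec a, farPoint a⟫ ≤ r := by
    rw [← hya, real_inner_smul_right]
    exact mul_le_of_le_one_right hr (hy (Sum.inr a))
  linarith

theorem no_polynomial_approximation_in_john_position
    (R : ℕ → ℝ) (hRpos : ∀ n, 0 < R n) (hRmono : Monotone R)
    (hRtop : Filter.Tendsto R Filter.atTop Filter.atTop)
    (hRsub : Filter.Tendsto (fun n => R n / n) Filter.atTop (nhds 0))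
    (k : ℝ) (hk : 0 < k) :
    ∀ᶠ n : ℕ in Filter.atTop,
      ∃ K : Set (EuclideanSpace ℝ (Fin n)), IsConvexBody K ∧ InJohnPosition K ∧
        ∀ (m : ℕ) (w : Fin m → EuclideanSpace ℝ (Fin n)),
          (m : ℝ) ≤ (n : ℝ) ^ k →
          ¬ (K ⊆ {x | ∀ l, ⟪x, w l⟫ ≤ 1} ∧
              {x : EuclideanSpace ℝ (Fin n) | ∀ l, ⟪x, w l⟫ ≤ 1} ⊆ R n • K) := by
  set q : ℕ := ⌈k⌉₊ + 1 with hq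
  set m : ℕ := 4 * q with hm
  have hkq : k + 1 ≤ q := by
    rw [hq]; push_cast; linarith [Nat.le_ceil k]
  have hR : ∀ᶠ n : ℕ in Filter.atTop, R n / n < 1 / (8 * ((m : ℝ) + 1)) :=
    hRsub.eventually_lt_const (by positivity)
  filter_upwards [hR, Filter.eventually_ge_atTop (8 * m),
    Filter.eventually_gt_atTop (m.choose q * (4 * m) ^ q)] with n hRn hn hnC
  have hn0 : n ≠ 0 := by omega
  have hn' : (0 : ℝ) < n := by exact_mod_cast Nat.pos_of_ne_zero hn0
  have hu : Set.range (simplexNormal n) ⊆ Set.range (Sum.elim (simplexNormal n)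
      (cutVec : (Fin m → Fin n) → EuclideanSpace ℝ (Fin n))) := by
    rw [Set.Sum.elim_range]
    exact Set.subset_union_left
  have hJ := isJohnFamily_simplexNormal hn0
  have hz : ∀ x, ‖Sum.elim (simplexNormal n)
      (cutVec : (Fin m → Fin n) → EuclideanSpace ℝ (Fin n)) x‖ ≤ 1 := by
    rintro (o | a)
    · exact (hJ.norm_eq_one o).le
    · exact norm_cutVec_le hn0 a
  refine ⟨_, hJ.isConvexBody_polarBody hu hz, hJ.inJohnPosition_polarBody hu hz, ?_⟩
  rintro N w hN ⟨hKP, hPK⟩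
  refine no_approximation_polarBody hm (by omega) hn ?_ (hRpos n).le ?_ w hKP hPK
  · have h1 : (N : ℝ) * n ≤ n ^ q := by
      calc (N : ℝ) * n ≤ (n : ℝ) ^ k * n := by gcongr
        _ = (n : ℝ) ^ (k + 1) := by rw [Real.rpow_add hn', Real.rpow_one]
        _ ≤ (n : ℝ) ^ (q : ℝ) := Real.rpow_le_rpow_of_exponent_le
            (by exact_mod_cast Nat.pos_of_ne_zero hn0) hkq
        _ = n ^ q := Real.rpow_natCast _ _
    have h2 : N * n ≤ n ^ q := by exact_mod_cast h1
    rcases N.eq_zero_or_pos with rfl | hN0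
    · simpa using Nat.pow_pos (Nat.pos_of_ne_zero hn0)
    · exact (Nat.mul_lt_mul_of_pos_left hnC hN0).trans_le h2
  · rw [div_lt_iff₀ hn'] at hRn
    rwa [one_div_mul_eq_div] at hRn
end

section
/- There is a universal constant c > 0 such that for all sufficiently large n the following holds: for every convex body K ⊂ ℝⁿ in John's position there exists a polytope P = {x ∈ ℝⁿ : ⟨x, w_l⟩ ≤ 1 for l = 1, …, m} with m ≤ exp(c · n · log n) such that (1/2)·P ⊆ K ⊆ P. -/
open MeasureTheory RealInnerProductSpace Pointwise

/-- A closed convex set containing the origin contains its bipolar set. -/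
theorem mem_of_forall_inner_le_one {E : Type*} [NormedAddCommGroup E] [InnerProductSpace ℝ E]
    [CompleteSpace E] {K : Set E} (hconv : Convex ℝ K) (hclosed : IsClosed K) (h0 : (0 : E) ∈ K)
    {y : E} (hy : ∀ v : E, (∀ k ∈ K, ⟪k, v⟫ ≤ 1) → ⟪y, v⟫ ≤ 1) : y ∈ K := by
  by_contra hyK
  obtain ⟨f, u, hf, hu⟩ := geometric_hahn_banach_closed_point hconv hclosed hyK
  have hu0 : 0 < u := by simpa using hf 0 h0
  have key : ∀ x : E, ⟪x, u⁻¹ • (InnerProductSpace.toDual ℝ E).symm f⟫ = f x / u := by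
    intro x
    rw [inner_smul_right, real_inner_comm, InnerProductSpace.toDual_symm_apply]
    ring
  have h1 := hy (u⁻¹ • (InnerProductSpace.toDual ℝ E).symm f) (fun k hk => by
    rw [key, div_le_one hu0]
    exact (hf k hk).le)
  rw [key, div_le_one hu0] at h1
  linarith

/-- The polar of a set containing the unit ball lies in the unit ball. -/
theorem norm_le_one_of_forall_inner_le_one {E : Type*} [NormedAddCommGroup E]
    [InnerProductSpace ℝ E] {K : Set E} (hK : Metric.closedBall 0 1 ⊆ K) {v : E}
    (hv : ∀ k ∈ K, ⟪k, v⟫ ≤ 1) : ‖v‖ ≤ 1 := by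
  rcases eq_or_ne v 0 with rfl | hv0
  · simp
  have hpos := norm_pos_iff.2 hv0
  have h := hv (‖v‖⁻¹ • v) (hK (by simp [norm_smul, hpos.ne']))
  rwa [real_inner_smul_left, real_inner_self_eq_norm_sq, sq, inv_mul_cancel_left₀ hpos.ne'] at h

/-- A subset of the Euclidean unit ball has an internal `n / N`-net of size `(2 * N + 1) ^ n`. -/
theorem exists_net_of_subset_closedBall {n N : ℕ} (hN : 0 < N)
    {A : Set (EuclideanSpace ℝ (Fin n))} (hA : A ⊆ Metric.closedBall 0 1) (hne : A.Nonempty) :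
    ∃ w : Fin ((2 * N + 1) ^ n) → EuclideanSpace ℝ (Fin n),
      (∀ l, w l ∈ A) ∧ ∀ a ∈ A, ∃ l, ‖a - w l‖ ≤ n / N := by
  classical
  have hN' : (0 : ℝ) < N := by exact_mod_cast hN
  have hcoord : ∀ a ∈ A, ∀ i, |a i| ≤ 1 := by
    intro a ha i
    have h1 := PiLp.norm_apply_le a i
    have h2 : ‖a‖ ≤ 1 := by simpa using hA ha
    rw [Real.norm_eq_abs] at h1
    linarith
  let cell (a : EuclideanSpace ℝ (Fin n)) : Fin n → Fin (2 * N + 1) :=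
    fun i => Fin.ofNat (2 * N + 1) ⌊(a i + 1) * N⌋₊
  have hcell : ∀ a ∈ A, ∀ i, ((cell a i : ℕ) : ℝ) ≤ (a i + 1) * N ∧
      (a i + 1) * N < (cell a i : ℕ) + 1 := by
    intro a ha i
    have h := abs_le.1 (hcoord a ha i)
    have h0 : 0 ≤ (a i + 1) * N := mul_nonneg (by linarith) hN'.le
    have hle : ⌊(a i + 1) * N⌋₊ ≤ 2 * N := by
      apply Nat.floor_le_of_le
      push_cast
      exact mul_le_mul_of_nonneg_right (by linarith) hN'.le
    have hval : (cell a i : ℕ) = ⌊(a i + 1) * N⌋₊ := by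
      simp only [cell, Fin.ofNat]
      exact Nat.mod_eq_of_lt (by omega)
    rw [hval]
    exact ⟨Nat.floor_le h0, Nat.lt_floor_add_one _⟩
  have hrep : ∀ j : Fin n → Fin (2 * N + 1), ∃ w ∈ A, (∃ a ∈ A, cell a = j) → cell w = j := by
    intro j
    by_cases h : ∃ a ∈ A, cell a = j
    · obtain ⟨a, ha, haj⟩ := h
      exact ⟨a, ha, fun _ => haj⟩
    · exact ⟨hne.some, hne.some_mem, fun h' => absurd h' h⟩
  choose w hwA hw using hrep
  let e : Fin ((2 * N + 1) ^ n) ≃ (Fin n → Fin (2 * N + 1)) :=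
    (Fintype.equivFinOfCardEq (by simp)).symm
  refine ⟨fun l => w (e l), fun l => hwA _, fun a ha => ⟨e.symm (cell a), ?_⟩⟩
  simp only [Equiv.apply_symm_apply]
  have hEq := hw (cell a) ⟨a, ha, rfl⟩
  have hdiff : ∀ i, ‖(a - w (cell a)) i‖ ^ 2 ≤ (1 / N : ℝ) ^ 2 := by
    intro i
    have h1 := hcell a ha i
    have h2 := hcell _ (hwA (cell a)) i
    rw [hEq] at h2
    have h3 : |a i - w (cell a) i| ≤ 1 / N := by
      have h4 : |(a i - w (cell a) i) * N| ≤ 1 := by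
        rw [abs_le]
        constructor <;> linarith
      rwa [le_div_iff₀ hN', ← abs_of_pos hN', ← abs_mul]
    rw [PiLp.sub_apply, Real.norm_eq_abs]
    exact pow_le_pow_left₀ (abs_nonneg _) h3 2
  refine (sq_le_sq₀ (norm_nonneg _) (by positivity)).1 ?_
  rw [EuclideanSpace.norm_sq_eq]
  calc ∑ i, ‖(a - w (cell a)) i‖ ^ 2 ≤ ∑ _i : Fin n, (1 / N : ℝ) ^ 2 :=
        Finset.sum_le_sum fun i _ => hdiff i
    _ = (n : ℝ) * (1 / N) ^ 2 := by simp
    _ ≤ (n : ℝ) ^ 2 * (1 / N) ^ 2 := by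
        apply mul_le_mul_of_nonneg_right _ (by positivity)
        exact_mod_cast Nat.le_self_pow two_ne_zero n
    _ = (n / N : ℝ) ^ 2 := by ring

/-- The ellipsoid centred at a unit vector `u` with semi-axis `2` along `u` and `b` orthogonally
to `u` lies in the half-space `⟪·, v⟫ ≤ 1` whenever `‖v‖ ≤ 1` and `⟪u, v⟫` is suitably bounded. -/
theorem inner_stretched_ball_le_one {E : Type*} [NormedAddCommGroup E] [InnerProductSpace ℝ E]
    {u v z : E} {b : ℝ} (hu : ‖u‖ = 1) (hv : ‖v‖ ≤ 1)
    (hz : ‖z‖ ≤ 1) (hs : b ^ 2 * (1 - ⟪u, v⟫) ≤ 1 - 3 * ⟪u, v⟫) :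
    ⟪u + (b • z + ((2 - b) * ⟪u, z⟫) • u), v⟫ ≤ 1 := by
  set s := ⟪u, v⟫ with hs_def
  have hsabs : |s| ≤ 1 := by
    have := abs_real_inner_le_norm u v
    rw [hu, one_mul] at this
    linarith
  obtain ⟨hs1, hs2⟩ := abs_le.1 hsabs
  have hvv : ‖v‖ ^ 2 ≤ 1 := pow_le_one₀ (norm_nonneg v) hv
  have hexp : ⟪u + (b • z + ((2 - b) * ⟪u, z⟫) • u), v⟫ =
      s + ⟪z, b • v + ((2 - b) * s) • u⟫ := by
    simp only [inner_add_left, inner_add_right, real_inner_smul_left, real_inner_smul_right,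
      ← hs_def, real_inner_comm z u]
    rw [real_inner_comm u z]
    ring
  have hnorm : ‖b • v + ((2 - b) * s) • u‖ ^ 2 = b ^ 2 * ‖v‖ ^ 2 + (4 - b ^ 2) * s ^ 2 := by
    rw [norm_add_sq_real, norm_smul, norm_smul, real_inner_smul_left, real_inner_smul_right,
      real_inner_comm, ← hs_def, hu, mul_pow, Real.norm_eq_abs, Real.norm_eq_abs, mul_one, sq_abs,
      sq_abs]
    ring
  have hle : ‖b • v + ((2 - b) * s) • u‖ ≤ 1 - s := by
    refine (sq_le_sq₀ (norm_nonneg _) (by linarith)).1 ?_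
    rw [hnorm]
    nlinarith [mul_le_mul_of_nonneg_left hs (by linarith : 0 ≤ 1 + s),
      mul_le_mul_of_nonneg_left hvv (sq_nonneg b)]
  have hcs : ⟪z, b • v + ((2 - b) * s) • u⟫ ≤ ‖b • v + ((2 - b) * s) • u‖ :=
    (real_inner_le_norm _ _).trans (mul_le_of_le_one_left (norm_nonneg _) hz)
  rw [hexp]
  linarith

/-- An invertible linear image of the unit ball, translated, is an ellipsoid of known volume. -/
theorem isEllipsoid_image_and_volume {n : ℕ}
    (f : EuclideanSpace ℝ (Fin n) →ₗ[ℝ] EuclideanSpace ℝ (Fin n)) (hf : LinearMap.det f ≠ 0)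
    (u : EuclideanSpace ℝ (Fin n)) :
    IsEllipsoid ((fun z => u + f z) '' Metric.closedBall 0 1) ∧
      volume ((fun z => u + f z) '' Metric.closedBall 0 1) =
        ENNReal.ofReal |LinearMap.det f| *
          volume (Metric.closedBall (0 : EuclideanSpace ℝ (Fin n)) 1) := by
  constructor
  · refine ⟨(LinearMap.equivOfIsUnitDet (isUnit_iff_ne_zero.2 hf)).toAffineEquiv.trans
      (AffineEquiv.constVAdd ℝ _ u), ?_⟩
    apply Set.image_congr
    intro z _
    simp
  · rw [← Measure.addHaar_image_linearMap, ← Set.image_image (fun y => u + y) f,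
      Set.image_add_left, measure_preimage_add]

/-- A convex body in John's position lies in a ball of radius linear in the dimension. -/
theorem InJohnPosition.norm_le {n : ℕ} (hn : 0 < n) {K : Set (EuclideanSpace ℝ (Fin n))}
    (hK : IsConvexBody K) (hJ : InJohnPosition K) {x : EuclideanSpace ℝ (Fin n)} (hx : x ∈ K) :
    ‖x‖ ≤ 4 * n + 1 := by
  by_contra! hlt
  have hn1 : (1 : ℝ) ≤ n := by exact_mod_cast hn
  have hx0 : 0 < ‖x‖ := by linarith
  set u : EuclideanSpace ℝ (Fin n) := ‖x‖⁻¹ • x with hu_def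
  have hu : ‖u‖ = 1 := by
    rw [hu_def, norm_smul, norm_inv, norm_norm, inv_mul_cancel₀ hx0.ne']
  set b : ℝ := 1 - 1 / (2 * n) with hb_def
  have hinv : 1 / (2 * n : ℝ) ≤ 1 / 2 := by
    apply one_div_le_one_div_of_le <;> linarith
  have hinv0 : 0 < 1 / (2 * n : ℝ) := by positivity
  have hb0 : 0 < b := by linarith
  have hb1 : b < 1 := by linarith
  let f : EuclideanSpace ℝ (Fin n) →ₗ[ℝ] EuclideanSpace ℝ (Fin n) :=
    b • LinearMap.transvection (innerₗ _ u) (((2 - b) / b) • u)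
  have hf : ∀ z, f z = b • z + ((2 - b) * ⟪u, z⟫) • u := by
    intro z
    simp only [f, LinearMap.smul_apply, LinearMap.transvection.apply, smul_add, smul_smul,
      innerₗ_apply_apply]
    congr 2
    field_simp
  have hdet : LinearMap.det f = b ^ n * (2 / b) := by
    simp only [f, LinearMap.det_smul, LinearMap.transvection.det, innerₗ_apply_apply,
      real_inner_smul_right, real_inner_self_eq_norm_sq, hu, finrank_euclideanSpace_fin]
    congr 1
    field_simp
    ring
  have hbern : 1 / 2 ≤ b ^ n := by
    have h := one_add_mul_le_pow (a := -(1 / (2 * n : ℝ))) (by linarith) n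
    have h' : (1 : ℝ) + n * -(1 / (2 * n)) = 1 / 2 := by
      field_simp
      norm_num
    rw [h', ← sub_eq_add_neg] at h
    exact h
  have hdet1 : 1 < LinearMap.det f := by
    rw [hdet]
    have h2 : 2 < 2 / b := by
      rw [lt_div_iff₀ hb0]
      linarith
    nlinarith
  obtain ⟨hE, hvol⟩ := isEllipsoid_image_and_volume f (by linarith) u
  have hsub : (fun z => u + f z) '' Metric.closedBall 0 1 ⊆ K := by
    rintro _ ⟨z, hz, rfl⟩
    apply mem_of_forall_inner_le_one hK.2.1 hK.1.isClosed (hJ.1 (by simp))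
    intro v hv
    have hv1 : ‖v‖ ≤ 1 := norm_le_one_of_forall_inner_le_one hJ.1 hv
    have hs : ⟪u, v⟫ ≤ 1 / (4 * n + 1) := by
      rw [hu_def, real_inner_smul_left]
      calc ‖x‖⁻¹ * ⟪x, v⟫ ≤ ‖x‖⁻¹ * 1 := mul_le_mul_of_nonneg_left (hv x hx) (by positivity)
        _ = 1 / ‖x‖ := by ring
        _ ≤ 1 / (4 * n + 1) := one_div_le_one_div_of_le (by linarith) hlt.le
    have hs' : ⟪u, v⟫ * (4 * n + 1) ≤ 1 := by rwa [le_div_iff₀ (by positivity)] at hs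
    have hs1 : ⟪u, v⟫ ≤ 1 := hs.trans (by rw [div_le_one (by positivity)]; linarith)
    change ⟪u + f z, v⟫ ≤ 1
    rw [hf]
    apply inner_stretched_ball_le_one hu hv1 (by simpa using hz)
    calc b ^ 2 * (1 - ⟪u, v⟫) ≤ b * (1 - ⟪u, v⟫) :=
          mul_le_mul_of_nonneg_right (by nlinarith) (by linarith)
      _ ≤ 1 - 3 * ⟪u, v⟫ := by
          rw [← sub_nonneg]
          have : 1 - 3 * ⟪u, v⟫ - b * (1 - ⟪u, v⟫) =
              (1 - ⟪u, v⟫ * (4 * n + 1)) / (2 * n) := by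
            rw [hb_def]
            field_simp
            ring
          rw [this]
          exact div_nonneg (by linarith) (by positivity)
  have hle := hJ.2 _ hE hsub
  rw [hvol] at hle
  have hpos : volume (Metric.closedBall (0 : EuclideanSpace ℝ (Fin n)) 1) ≠ 0 :=
    (Metric.measure_closedBall_pos volume 0 one_pos).ne'
  have hfin : volume (Metric.closedBall (0 : EuclideanSpace ℝ (Fin n)) 1) ≠ ⊤ :=
    measure_closedBall_lt_top.ne
  have hgt : 1 < ENNReal.ofReal |LinearMap.det f| := by
    rw [ENNReal.one_lt_ofReal]
    exact hdet1.trans_le (le_abs_self _)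
  have hlt' := ENNReal.mul_lt_mul_left hpos hfin hgt
  rw [one_mul] at hlt'
  exact absurd hle hlt'.not_ge

/-- A polytope cut out by a fine net of the polar body approximates the body up to factor `2`. -/
theorem half_smul_polytope_subset {E ι : Type*} [NormedAddCommGroup E] [InnerProductSpace ℝ E]
    [CompleteSpace E] {K : Set E} (hconv : Convex ℝ K) (hclosed : IsClosed K) (h0 : (0 : E) ∈ K)
    {R : ℝ} (hR : 0 < R) (hK : ∀ k ∈ K, ‖k‖ ≤ R) {w : ι → E}
    (hw : ∀ v : E, (∀ k ∈ K, ⟪k, v⟫ ≤ 1) → ∃ l, ‖v - w l‖ ≤ 1 / (2 * R)) :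
    (1 / 2 : ℝ) • {x : E | ∀ l, ⟪x, w l⟫ ≤ 1} ⊆ K := by
  rintro _ ⟨x, hx, rfl⟩
  have happrox : ∀ v : E, (∀ k ∈ K, ⟪k, v⟫ ≤ 1) → ⟪x, v⟫ ≤ 1 + ‖x‖ / (2 * R) := by
    intro v hv
    obtain ⟨l, hl⟩ := hw v hv
    calc ⟪x, v⟫ = ⟪x, w l⟫ + ⟪x, v - w l⟫ := by rw [inner_sub_right]; ring
      _ ≤ 1 + ‖x‖ * (1 / (2 * R)) := add_le_add (hx l)
          ((real_inner_le_norm _ _).trans (mul_le_mul_of_nonneg_left hl (norm_nonneg x)))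
      _ = 1 + ‖x‖ / (2 * R) := by ring
  have hxR : ‖x‖ ≤ 2 * R := by
    rcases eq_or_ne x 0 with rfl | hx0
    · simpa using hR.le
    have hpos := norm_pos_iff.2 hx0
    have h := happrox ((R⁻¹ * ‖x‖⁻¹) • x) (fun k hk => by
      rw [real_inner_smul_right]
      calc R⁻¹ * ‖x‖⁻¹ * ⟪k, x⟫ ≤ R⁻¹ * ‖x‖⁻¹ * (R * ‖x‖) := by
            apply mul_le_mul_of_nonneg_left _ (by positivity)
            exact (real_inner_le_norm _ _).trans
              (mul_le_mul_of_nonneg_right (hK k hk) hpos.le)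
        _ = 1 := by field_simp)
    rw [real_inner_smul_right, real_inner_self_eq_norm_sq] at h
    field_simp at h
    linarith
  apply mem_of_forall_inner_le_one hconv hclosed h0
  intro v hv
  have h1 := happrox v hv
  have h2 : ‖x‖ / (2 * R) ≤ 1 := by rwa [div_le_one (by positivity)]
  change ⟪(1 / 2 : ℝ) • x, v⟫ ≤ 1
  rw [real_inner_smul_left]
  linarith

theorem john_position_factor_two_approximation :
    ∃ c : ℝ, 0 < c ∧
      ∀ᶠ n : ℕ in Filter.atTop,
        ∀ K : Set (EuclideanSpace ℝ (Fin n)), IsConvexBody K → InJohnPosition K →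
          ∃ (m : ℕ) (w : Fin m → EuclideanSpace ℝ (Fin n)),
            (m : ℝ) ≤ Real.exp (c * n * Real.log n) ∧
            (1 / 2 : ℝ) • {x : EuclideanSpace ℝ (Fin n) | ∀ l, ⟪x, w l⟫ ≤ 1} ⊆ K ∧
            K ⊆ {x : EuclideanSpace ℝ (Fin n) | ∀ l, ⟪x, w l⟫ ≤ 1} := by
  refine ⟨7, by norm_num, ?_⟩
  filter_upwards [Filter.eventually_ge_atTop 2] with n hn K hK hJ
  have hn2 : (2 : ℝ) ≤ n := by exact_mod_cast hn
  have h0 : (0 : EuclideanSpace ℝ (Fin n)) ∈ K := hJ.1 (by simp)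
  let A : Set (EuclideanSpace ℝ (Fin n)) := {v | ∀ k ∈ K, ⟪k, v⟫ ≤ 1}
  have hA : A ⊆ Metric.closedBall 0 1 := by
    intro v hv
    rw [mem_closedBall_zero_iff]
    exact norm_le_one_of_forall_inner_le_one hJ.1 hv
  obtain ⟨w, hwA, hw⟩ := exists_net_of_subset_closedBall (N := 2 * n * (4 * n + 1))
    (by positivity) hA ⟨0, fun k _ => by simp⟩
  refine ⟨_, w, ?_, ?_, fun k hk l => hwA l k hk⟩
  · have hn0 : (0 : ℝ) < n := by linarith
    have hexp : Real.exp (7 * n * Real.log n) = ((n : ℝ) ^ 7) ^ n := by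
      rw [← pow_mul, ← Real.exp_log (pow_pos hn0 (7 * n)), Real.log_pow]
      push_cast
      rfl
    rw [hexp]
    push_cast
    apply pow_le_pow_left₀ (by positivity)
    have h5 : (32 : ℝ) ≤ (n : ℝ) ^ 5 := by
      calc (32 : ℝ) = 2 ^ 5 := by norm_num
        _ ≤ (n : ℝ) ^ 5 := pow_le_pow_left₀ (by norm_num) hn2 5
    calc (2 * (2 * n * (4 * n + 1)) + 1 : ℝ) ≤ 32 * (n : ℝ) ^ 2 := by nlinarith
      _ ≤ (n : ℝ) ^ 5 * (n : ℝ) ^ 2 := mul_le_mul_of_nonneg_right h5 (by positivity)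
      _ = (n : ℝ) ^ 7 := by ring
  · refine half_smul_polytope_subset hK.2.1 hK.1.isClosed h0 (by positivity : (0 : ℝ) < 4 * n + 1)
      (fun k hk => hJ.norm_le (by omega) hK hk) fun v hv => ?_
    obtain ⟨l, hl⟩ := hw v hv
    refine ⟨l, hl.trans_eq ?_⟩
    push_cast
    field_simp
end

section
/- For all sufficiently large n ∈ ℕ and every integer k with 100 < k < n/(2e⁸), the number of ordered pairs (I, J) of k-element subsets of {1, …, n} satisfying |I ∩ J| ≥ k/2 is at most (2k/n)^{k/5} · (C(n,k))². Equivalently, if I and J are chosen independently and uniformly at random among k-element subsets of {1, …, n}, then ℙ(|I ∩ J| ≥ k/2) ≤ (2k/n)^{k/5}. -/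
/-- Replacing a binomial coefficient by the one with `m` fewer elements above and below costs at
least a factor `(n / k) ^ m`. -/
theorem choose_sub_mul_pow_le {n k : ℕ} (hkn : k ≤ n) (m : ℕ) (hm : m ≤ k) :
    (n - m).choose (k - m) * n ^ m ≤ n.choose k * k ^ m := by
  induction m with
  | zero => simp
  | succ m ih =>
    have ih := ih (by omega)
    obtain ⟨b, rfl⟩ := Nat.exists_eq_add_of_le hm
    obtain ⟨d, rfl⟩ := Nat.exists_eq_add_of_le hkn
    have h1 : m + 1 + b + d - m = (b + d) + 1 := by omega
    have h2 : m + 1 + b - m = b + 1 := by omega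
    have h3 : m + 1 + b + d - (m + 1) = b + d := by omega
    have h4 : m + 1 + b - (m + 1) = b := by omega
    rw [h1, h2] at ih
    rw [h3, h4]
    have hs := Nat.add_one_mul_choose_eq (b + d) b
    have hstep : (b + d).choose b * (m + 1 + b + d)
        ≤ ((b + d) + 1).choose (b + 1) * (m + 1 + b) := by
      refine Nat.le_of_mul_le_mul_right ?_ (Nat.succ_pos b)
      calc (b + d).choose b * (m + 1 + b + d) * (b + 1)
          = (b + d).choose b * ((m + 1 + b + d) * (b + 1)) := by ring
        _ ≤ (b + d).choose b * ((b + d + 1) * (m + 1 + b)) := by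
          refine Nat.mul_le_mul_left _ ?_
          nlinarith [Nat.zero_le (m * d)]
        _ = ((b + d + 1) * (b + d).choose b) * (m + 1 + b) := by ring
        _ = _ := by rw [hs, Nat.succ_eq_add_one]; ring
    calc (b + d).choose b * (m + 1 + b + d) ^ (m + 1)
        = ((b + d).choose b * (m + 1 + b + d)) * (m + 1 + b + d) ^ m := by ring
      _ ≤ (((b + d) + 1).choose (b + 1) * (m + 1 + b)) * (m + 1 + b + d) ^ m :=
        Nat.mul_le_mul_right _ hstep
      _ = (((b + d) + 1).choose (b + 1) * (m + 1 + b + d) ^ m) * (m + 1 + b) := by ring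
      _ ≤ _ := Nat.mul_le_mul_right _ ih
      _ = _ := by ring

/-- Upper bound for the number of `k`-element subsets of `s` containing a given subset `t`. -/
theorem card_filter_subset_powersetCard_le {α : Type*} [DecidableEq α] {s t : Finset α}
    (hts : t ⊆ s) (k : ℕ) :
    ((s.powersetCard k).filter (fun u => t ⊆ u)).card
      ≤ (s.card - t.card).choose (k - t.card) := by
  rw [← Finset.card_sdiff_of_subset hts, ← Finset.card_powersetCard]
  refine le_trans (Finset.card_le_card ?_)
    (Finset.card_image_le (s := (s \ t).powersetCard (k - t.card)) (f := fun v => t ∪ v))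
  intro u hu
  simp only [Finset.mem_filter, Finset.mem_powersetCard] at hu
  obtain ⟨⟨hus, huk⟩, htu⟩ := hu
  refine Finset.mem_image.2 ⟨u \ t, Finset.mem_powersetCard.2
    ⟨Finset.sdiff_subset_sdiff hus subset_rfl, ?_⟩, Finset.union_sdiff_of_subset htu⟩
  rw [Finset.card_sdiff_of_subset htu, huk]

/-- Union bound for the number of `k`-element subsets of `s` meeting `t` in at least `m`
elements. -/
theorem card_filter_le_card_inter_le {α : Type*} [DecidableEq α] {s t : Finset α}
    (hts : t ⊆ s) (k m : ℕ) :
    ((s.powersetCard k).filter (fun u => m ≤ (t ∩ u).card)).card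
      ≤ t.card.choose m * (s.card - m).choose (k - m) := by
  rw [← Finset.card_powersetCard]
  refine le_trans (Finset.card_le_card ?_) (Finset.card_biUnion_le_card_mul (t.powersetCard m)
    (fun v => (s.powersetCard k).filter (fun u => v ⊆ u)) _ ?_)
  · intro u hu
    rw [Finset.mem_filter] at hu
    obtain ⟨v, hv, hvm⟩ := Finset.exists_subset_card_eq hu.2
    exact Finset.mem_biUnion.2 ⟨v, Finset.mem_powersetCard.2
      ⟨hv.trans Finset.inter_subset_left, hvm⟩,
      Finset.mem_filter.2 ⟨hu.1, hv.trans Finset.inter_subset_right⟩⟩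
  · intro v hv
    obtain ⟨hvt, rfl⟩ := Finset.mem_powersetCard.1 hv
    exact card_filter_subset_powersetCard_le (hvt.trans hts) k

/-- Union bound for the number of pairs of `k`-element subsets of `s` sharing at least half of
their elements. -/
theorem card_filter_le_two_mul_card_inter_le {α : Type*} [DecidableEq α] (s : Finset α) (k : ℕ) :
    ((s.powersetCard k ×ˢ s.powersetCard k).filter
        (fun p => k ≤ 2 * (p.1 ∩ p.2).card)).card
      ≤ s.card.choose k * (2 ^ k * (s.card - (k + 1) / 2).choose (k - (k + 1) / 2)) := by
  rw [Finset.card_filter, Finset.sum_product, ← Finset.card_powersetCard k s, ← smul_eq_mul]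
  refine Finset.sum_le_card_nsmul _ _ _ fun t ht => ?_
  obtain ⟨hts, htk⟩ := Finset.mem_powersetCard.1 ht
  rw [← Finset.card_filter]
  calc _ ≤ ((s.powersetCard k).filter (fun u => (k + 1) / 2 ≤ (t ∩ u).card)).card := by
        refine Finset.card_le_card (Finset.monotone_filter_right _ fun u _ hu => ?_)
        simp only at hu ⊢
        omega
    _ ≤ _ := card_filter_le_card_inter_le hts k _
    _ ≤ _ := by
        rw [htk]
        exact Nat.mul_le_mul_right _ (Nat.choose_le_two_pow _ _)

theorem two_pow_mul_pow_le_rpow {y : ℝ} (hy : 0 < y) (hy8 : 2 * y < Real.exp (-8))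
    {k m : ℕ} (hkm : k ≤ 2 * m) :
    2 ^ k * y ^ m ≤ (2 * y) ^ ((k : ℝ) / 5) := by
  have hlog : Real.log 2 + Real.log y < -8 := by
    rw [← Real.log_mul two_ne_zero hy.ne']
    exact (Real.log_lt_iff_lt_exp (by positivity)).2 hy8
  have h2 := Real.log_two_lt_d9
  have h2' := Real.log_two_gt_d9
  have hkm' : (k : ℝ) ≤ 2 * m := by exact_mod_cast hkm
  have hk : (0 : ℝ) ≤ k := Nat.cast_nonneg k
  rw [← Real.log_le_log_iff (by positivity) (by positivity),
    Real.log_mul (by positivity) (by positivity), Real.log_pow, Real.log_pow,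
    Real.log_rpow (by positivity), Real.log_mul two_ne_zero hy.ne']
  have h3 : (2 * (m : ℝ) - k) * Real.log y ≤ 0 :=
    mul_nonpos_of_nonneg_of_nonpos (by linarith) (by linarith)
  have h4 : (k : ℝ) * (8 * Real.log 2 + 3 * Real.log y) ≤ 0 :=
    mul_nonpos_of_nonneg_of_nonpos hk (by linarith)
  nlinarith

theorem hypergeometric_tail_bound :
    ∀ᶠ n : ℕ in Filter.atTop, ∀ k : ℕ,
      100 < k → (k : ℝ) < n / (2 * Real.exp 8) →
      (((((Finset.range n).powersetCard k ×ˢ (Finset.range n).powersetCard k).filter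
          (fun p => k ≤ 2 * (p.1 ∩ p.2).card)).card : ℝ)
        ≤ (2 * k / n : ℝ) ^ ((k : ℝ) / 5) * (n.choose k : ℝ) ^ 2) := by
  filter_upwards [Filter.eventually_gt_atTop 0] with n hn k hk hkn
  have hn' : (0 : ℝ) < n := Nat.cast_pos.2 hn
  have hk' : (0 : ℝ) < k := Nat.cast_pos.2 (by omega)
  rw [lt_div_iff₀ (by positivity)] at hkn
  have hle : k ≤ n := by
    have : (k : ℝ) ≤ n := by nlinarith [Real.add_one_le_exp (8 : ℝ)]
    exact_mod_cast this
  have hx : 2 * ((k : ℝ) / n) < Real.exp (-8) := by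
    rw [Real.exp_neg, ← one_div, ← mul_div_assoc, div_lt_div_iff₀ hn' (Real.exp_pos 8)]
    linarith
  set m := (k + 1) / 2 with hm
  have hcard := card_filter_le_two_mul_card_inter_le (Finset.range n) k
  rw [Finset.card_range, ← hm] at hcard
  have hchoose : ((n - m).choose (k - m) : ℝ) ≤ n.choose k * ((k : ℝ) / n) ^ m := by
    rw [div_pow, ← mul_div_assoc, le_div_iff₀ (by positivity)]
    exact_mod_cast choose_sub_mul_pow_le hle m (by omega)
  have hpow := two_pow_mul_pow_le_rpow (y := (k : ℝ) / n) (by positivity) hx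
    (k := k) (m := m) (by omega)
  calc _ ≤ (n.choose k : ℝ) * (2 ^ k * ((n - m).choose (k - m) : ℝ)) := by
        exact_mod_cast hcard
    _ ≤ (n.choose k : ℝ) * (2 ^ k * (n.choose k * ((k : ℝ) / n) ^ m)) := by gcongr
    _ = (2 ^ k * ((k : ℝ) / n) ^ m) * (n.choose k : ℝ) ^ 2 := by ring
    _ ≤ _ := by
        rw [mul_div_assoc]
        gcongr
end

section
/- Let n, k, l be positive integers with 2k < n, n/(2k) ≥ e⁸, and k/2 ≤ l ≤ k. Then C(k,l)·C(n−k, k−l)/C(n,k) ≤ exp(−(k/4)·log(n/(2k))). -/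
theorem Nat.descFactorial_mul_pow_le {k n : ℕ} (h : k ≤ n) (l : ℕ) :
    k.descFactorial l * n ^ l ≤ n.descFactorial l * k ^ l := by
  induction l with
  | zero => simp
  | succ l ih =>
    have hstep : (k - l) * n ≤ (n - l) * k := by
      rw [Nat.sub_mul, Nat.sub_mul, Nat.mul_comm k n]
      exact Nat.sub_le_sub_left (Nat.mul_le_mul_left l h) _
    calc k.descFactorial (l + 1) * n ^ (l + 1)
        = ((k - l) * n) * (k.descFactorial l * n ^ l) := by
          rw [Nat.descFactorial_succ]; ring
      _ ≤ ((n - l) * k) * (n.descFactorial l * k ^ l) := Nat.mul_le_mul hstep ih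
      _ = n.descFactorial (l + 1) * k ^ (l + 1) := by
          rw [Nat.descFactorial_succ]; ring

theorem Nat.choose_mul_pow_le {k n : ℕ} (h : k ≤ n) (l : ℕ) :
    k.choose l * n ^ l ≤ n.choose l * k ^ l := by
  have hd := Nat.descFactorial_mul_pow_le h l
  rw [Nat.descFactorial_eq_factorial_mul_choose, Nat.descFactorial_eq_factorial_mul_choose,
    Nat.mul_assoc, Nat.mul_assoc] at hd
  exact Nat.le_of_mul_le_mul_left hd l.factorial_pos

/-- A hypergeometric point probability is at most `2 ^ k * (k / n) ^ l`. -/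
theorem choose_mul_choose_div_choose_le {n k l : ℕ} (hk : 0 < k) (hkn : k ≤ n) (hlk : l ≤ k) :
    ((k.choose l : ℝ) * ((n - k).choose (k - l) : ℝ)) / (n.choose k : ℝ)
      ≤ 2 ^ k * ((k : ℝ) / n) ^ l := by
  have hn : (0 : ℝ) < n := by exact_mod_cast hk.trans_le hkn
  have hnk : (0 : ℝ) < n.choose k := by exact_mod_cast Nat.choose_pos hkn
  have hnl : 0 < n.choose l := Nat.choose_pos (hlk.trans hkn)
  have hmono : (n - k).choose (k - l) ≤ (n - l).choose (k - l) :=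
    Nat.choose_le_choose _ (Nat.sub_le_sub_left hlk n)
  have hprod : n.choose l * ((n - k).choose (k - l) * n ^ l)
      ≤ n.choose l * (n.choose k * k ^ l) := by
    calc n.choose l * ((n - k).choose (k - l) * n ^ l)
        ≤ n.choose l * ((n - l).choose (k - l) * n ^ l) := by gcongr
      _ = n.choose k * (k.choose l * n ^ l) := by
          rw [← Nat.mul_assoc, ← Nat.choose_mul hlk, Nat.mul_assoc]
      _ ≤ n.choose k * (n.choose l * k ^ l) :=
          Nat.mul_le_mul_left _ (Nat.choose_mul_pow_le hkn l)
      _ = n.choose l * (n.choose k * k ^ l) := by ring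
  have hmain : ((n - k).choose (k - l) : ℝ) * (n : ℝ) ^ l ≤ n.choose k * (k : ℝ) ^ l := by
    exact_mod_cast Nat.le_of_mul_le_mul_left hprod hnl
  have htwo : (k.choose l : ℝ) ≤ 2 ^ k := by exact_mod_cast Nat.choose_le_two_pow k l
  rw [mul_div_assoc]
  refine mul_le_mul htwo ?_ (by positivity) (by positivity)
  rw [div_pow, div_le_div_iff₀ hnk (by positivity)]
  linarith

theorem hypergeometric_term_bound
    (n k l : ℕ) (hk : 0 < k) (hl : 0 < l)
    (h2k : 2 * k < n) (hexp : Real.exp 8 ≤ (n : ℝ) / (2 * k))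
    (hlow : (k : ℝ) / 2 ≤ l) (hup : l ≤ k) :
    ((k.choose l : ℝ) * ((n - k).choose (k - l) : ℝ)) / (n.choose k : ℝ)
      ≤ Real.exp (-((k : ℝ) / 4) * Real.log ((n : ℝ) / (2 * k))) := by
  have hk0 : (0 : ℝ) < k := by exact_mod_cast hk
  have hn0 : (0 : ℝ) < n := by exact_mod_cast (by omega : 0 < n)
  have hx : (0 : ℝ) < (n : ℝ) / (2 * k) := by positivity
  refine (choose_mul_choose_div_choose_le hk (by omega) hup).trans ?_
  have hL : 8 ≤ Real.log ((n : ℝ) / (2 * k)) := (Real.le_log_iff_exp_le hx).2 hexp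
  have hratio : (k : ℝ) / n = (2 * ((n : ℝ) / (2 * k)))⁻¹ := by field_simp
  rw [hratio]
  generalize (n : ℝ) / (2 * k) = x at hx hL
  rw [← Real.log_le_iff_le_exp (by positivity), Real.log_mul (by positivity) (by positivity),
    Real.log_pow, Real.log_pow, Real.log_inv, Real.log_mul two_ne_zero hx.ne']
  have h2 := Real.log_two_lt_d9
  have h2' : 0 < Real.log 2 := Real.log_pos one_lt_two
  have hmul : (k : ℝ) / 2 * (Real.log 2 + Real.log x) ≤ l * (Real.log 2 + Real.log x) :=
    mul_le_mul_of_nonneg_right hlow (by linarith)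
  have hlog : (k : ℝ) * (2 * Real.log 2) ≤ k * Real.log x :=
    mul_le_mul_of_nonneg_left (by linarith) hk0.le
  linarith
end

section
/- For all sufficiently large n and every integer k with 100 ≤ k ≤ n/(2e⁸), setting m := ⌈(n/(2k))^{k/20}⌉, there exist k-element subsets I₁, …, I_m of {1, …, n} such that |I_i ∩ I_j| < k/2 for all 1 ≤ i < j ≤ m. -/
/-- A Gilbert–Varshamov bound: if every `r`-neighbourhood in `U` has at most `A` elements, then
some `r`-independent subset of `U` has at least `#U / A` elements. -/
theorem exists_independent_card_mul_ge {α : Type*} [DecidableEq α] (U : Finset α)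
    (r : α → α → Prop) [DecidableRel r] (hrefl : ∀ a ∈ U, r a a) (hsymm : ∀ a b, r a b → r b a)
    (A : ℕ) (hA : ∀ a ∈ U, (U.filter (r a)).card ≤ A) :
    ∃ F ⊆ U, (∀ a ∈ F, ∀ b ∈ F, a ≠ b → ¬ r a b) ∧ U.card ≤ F.card * A := by
  let P := U.powerset.filter fun F => ∀ a ∈ F, ∀ b ∈ F, a ≠ b → ¬ r a b
  obtain ⟨F, hF, hmax⟩ := P.exists_max_image Finset.card ⟨∅, by simp [P]⟩
  simp only [P, Finset.mem_filter, Finset.mem_powerset] at hF hmax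
  refine ⟨F, hF.1, hF.2, ?_⟩
  have hcover : U ⊆ F.biUnion fun a => U.filter (r a) := by
    intro t ht
    simp only [Finset.mem_biUnion, Finset.mem_filter]
    by_contra! hcon
    have htF : t ∉ F := fun h => hcon t h ht (hrefl t ht)
    have := hmax (insert t F) ⟨Finset.insert_subset ht hF.1, by
      intro a ha b hb hab
      rw [Finset.mem_insert] at ha hb
      rcases ha with rfl | ha <;> rcases hb with rfl | hb
      · exact absurd rfl hab
      · exact fun h => hcon b hb ht (hsymm _ _ h)
      · exact hcon a ha ht
      · exact hF.2 a ha b hb hab⟩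
    rw [Finset.card_insert_of_notMem htF] at this
    omega
  exact (Finset.card_le_card hcover).trans
    (Finset.card_biUnion_le_card_mul _ _ _ fun a ha => hA a (hF.1 ha))

theorem card_powersetCard_filter_superset_le {α : Type*} [DecidableEq α] {X J : Finset α}
    (hJ : J ⊆ X) (k : ℕ) :
    ((X.powersetCard k).filter (J ⊆ ·)).card ≤ (X.card - J.card).choose (k - J.card) := by
  rw [← Finset.card_sdiff_of_subset hJ, ← Finset.card_powersetCard]
  refine Finset.card_le_card_of_injOn (· \ J) ?_ ?_
  · intro T hT
    simp only [Finset.coe_filter, Finset.mem_powersetCard, Set.mem_ofPred_eq] at hT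
    simp only [Finset.mem_coe, Finset.mem_powersetCard]
    exact ⟨Finset.sdiff_subset_sdiff hT.1.1 subset_rfl, by
      rw [Finset.card_sdiff_of_subset hT.2, hT.1.2]⟩
  · intro T hT T' hT' h
    simp only [Finset.coe_filter, Set.mem_ofPred_eq] at hT hT'
    rw [← Finset.sdiff_union_of_subset hT.2, ← Finset.sdiff_union_of_subset hT'.2]
    exact congrArg (· ∪ J) h

theorem card_powersetCard_filter_le_card_inter_le {α : Type*} [DecidableEq α] {X S : Finset α}
    (hS : S ⊆ X) (k h : ℕ) :
    ((X.powersetCard k).filter fun T => h ≤ (S ∩ T).card).card ≤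
      S.card.choose h * (X.card - h).choose (k - h) := by
  have hcover : ((X.powersetCard k).filter fun T => h ≤ (S ∩ T).card) ⊆
      (S.powersetCard h).biUnion fun J => (X.powersetCard k).filter (J ⊆ ·) := by
    intro T hT
    rw [Finset.mem_filter] at hT
    obtain ⟨J, hJ, hJc⟩ := Finset.exists_subset_card_eq hT.2
    simp only [Finset.mem_biUnion, Finset.mem_filter, Finset.mem_powersetCard]
    exact ⟨J, ⟨hJ.trans Finset.inter_subset_left, hJc⟩, Finset.mem_powersetCard.1 hT.1,
      hJ.trans Finset.inter_subset_right⟩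
  refine (Finset.card_le_card hcover).trans ?_
  rw [← Finset.card_powersetCard h S]
  refine Finset.card_biUnion_le_card_mul _ _ _ fun J hJ => ?_
  rw [Finset.mem_powersetCard] at hJ
  simpa [hJ.2] using card_powersetCard_filter_superset_le (hJ.1.trans hS) k

theorem pow_mul_descFactorial_le {n k : ℕ} (hkn : k ≤ n) (h : ℕ) :
    n ^ h * k.descFactorial h ≤ k ^ h * n.descFactorial h := by
  induction h with
  | zero => simp
  | succ h ih =>
    rw [Nat.descFactorial_succ, Nat.descFactorial_succ, pow_succ, pow_succ]
    have hstep : n * (k - h) ≤ k * (n - h) := by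
      rw [Nat.mul_sub, Nat.mul_sub, mul_comm n k]
      exact Nat.sub_le_sub_left (Nat.mul_le_mul_right h hkn) _
    calc n ^ h * n * ((k - h) * k.descFactorial h)
        = (n ^ h * k.descFactorial h) * (n * (k - h)) := by ring
      _ ≤ (k ^ h * n.descFactorial h) * (k * (n - h)) := Nat.mul_le_mul ih hstep
      _ = _ := by ring

theorem pow_mul_choose_le {n k : ℕ} (hkn : k ≤ n) (h : ℕ) :
    n ^ h * k.choose h ≤ k ^ h * n.choose h := by
  have := pow_mul_descFactorial_le hkn h
  rw [Nat.descFactorial_eq_factorial_mul_choose, Nat.descFactorial_eq_factorial_mul_choose] at this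
  exact Nat.le_of_mul_le_mul_left (by linarith) h.factorial_pos

theorem exists_family_card_inter_lt {n k h : ℕ} (hkn : k ≤ n) (hhk : h ≤ k) :
    ∃ F ⊆ (Finset.range n).powersetCard k,
      (∀ S ∈ F, ∀ T ∈ F, S ≠ T → (S ∩ T).card < h) ∧ n ^ h ≤ F.card * 2 ^ k * k ^ h := by
  obtain ⟨F, hFU, hF, hcard⟩ := exists_independent_card_mul_ge ((Finset.range n).powersetCard k)
    (fun S T => h ≤ (S ∩ T).card)
    (fun S hS => by rw [Finset.inter_self, (Finset.mem_powersetCard.1 hS).2]; exact hhk)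
    (fun S T hST => by rwa [Finset.inter_comm])
    (k.choose h * (n - h).choose (k - h)) (fun S hS => by
      rw [Finset.mem_powersetCard] at hS
      simpa [hS.2] using card_powersetCard_filter_le_card_inter_le hS.1 k h)
  refine ⟨F, hFU, fun S hS T hT hST => not_le.1 (hF S hS T hT hST), ?_⟩
  rw [Finset.card_powersetCard, Finset.card_range] at hcard
  have hpos : 0 < (n - h).choose (k - h) := Nat.choose_pos (by omega)
  have hpos' : 0 < k.choose h := Nat.choose_pos hhk
  have hchoose : n.choose h ≤ F.card * k.choose h * k.choose h := by
    refine Nat.le_of_mul_le_mul_right ?_ hpos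
    rw [← Nat.choose_mul hhk]
    calc n.choose k * k.choose h
        ≤ F.card * (k.choose h * (n - h).choose (k - h)) * k.choose h :=
          Nat.mul_le_mul_right _ hcard
      _ = _ := by ring
  have hpow : n ^ h ≤ F.card * k.choose h * k ^ h := by
    refine Nat.le_of_mul_le_mul_right ?_ hpos'
    calc n ^ h * k.choose h ≤ k ^ h * n.choose h := pow_mul_choose_le hkn h
      _ ≤ k ^ h * (F.card * k.choose h * k.choose h) := Nat.mul_le_mul_left _ hchoose
      _ = _ := by ring
  refine hpow.trans ?_
  gcongr
  exact Nat.choose_le_two_pow k h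

theorem rpow_mul_two_pow_le {x : ℝ} (hx : 4 ≤ x) {k h : ℕ} (hkh : k ≤ 2 * h) :
    x ^ ((k : ℝ) / 20) * 2 ^ k ≤ (2 * x) ^ h := by
  have hx0 : 0 < x := by linarith
  have hkh' : (k : ℝ) ≤ 2 * h := by exact_mod_cast hkh
  have hk0 : (0 : ℝ) ≤ k := k.cast_nonneg
  calc x ^ ((k : ℝ) / 20) * 2 ^ k
      = x ^ ((k : ℝ) / 20) * ((2 : ℝ) ^ ((k : ℝ) / 2) * (4 : ℝ) ^ ((k : ℝ) / 4)) := by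
        have h4 : (4 : ℝ) ^ ((k : ℝ) / 4) = 2 ^ ((k : ℝ) / 2) := by
          rw [show (k : ℝ) / 2 = 2 * (k / 4) by ring, Real.rpow_mul (by norm_num)]
          norm_num
        rw [h4, ← Real.rpow_add (by norm_num), add_halves, Real.rpow_natCast]
    _ ≤ x ^ ((k : ℝ) / 4) * ((2 : ℝ) ^ ((k : ℝ) / 2) * x ^ ((k : ℝ) / 4)) := by
        gcongr <;> linarith
    _ = (2 * x) ^ ((k : ℝ) / 2) := by
        rw [Real.mul_rpow (by norm_num) hx0.le, mul_left_comm, ← Real.rpow_add hx0]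
        congr 2
        ring
    _ ≤ (2 * x) ^ (h : ℝ) := Real.rpow_le_rpow_of_exponent_le (by linarith) (by linarith)
    _ = (2 * x) ^ h := Real.rpow_natCast _ _

theorem exists_many_subsets_small_intersections :
    ∀ᶠ n : ℕ in Filter.atTop, ∀ k : ℕ,
      100 ≤ k → (k : ℝ) ≤ n / (2 * Real.exp 8) →
      ∃ I : Fin ⌈((n : ℝ) / (2 * k)) ^ ((k : ℝ) / 20)⌉₊ → Finset ℕ,
        (∀ i, I i ⊆ Finset.range n ∧ (I i).card = k) ∧
        ∀ i j, i < j → 2 * (I i ∩ I j).card < k := by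
  refine Filter.Eventually.of_forall fun n k hk hkn => ?_
  have hk0 : (0 : ℝ) < k := by exact_mod_cast (by omega : 0 < k)
  have hx : (4 : ℝ) ≤ n / (2 * k) := by
    rw [le_div_iff₀ (by positivity)] at hkn ⊢
    have := Real.add_one_le_exp (8 : ℝ)
    nlinarith
  have hkn' : k ≤ n := by
    rw [le_div_iff₀ (by positivity)] at hx
    exact_mod_cast (by linarith : (k : ℝ) ≤ n)
  obtain ⟨F, hFU, hF, hcard⟩ :=
    exists_family_card_inter_lt (h := (k + 1) / 2) hkn' (by omega)
  have hm : ⌈((n : ℝ) / (2 * k)) ^ ((k : ℝ) / 20)⌉₊ ≤ F.card := by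
    rw [Nat.ceil_le]
    have hpow := rpow_mul_two_pow_le hx (k := k) (h := (k + 1) / 2) (by omega)
    rw [show 2 * ((n : ℝ) / (2 * k)) = n / k by field_simp, div_pow,
      le_div_iff₀ (by positivity)] at hpow
    have hcard' : (n : ℝ) ^ ((k + 1) / 2) ≤ F.card * 2 ^ k * (k : ℝ) ^ ((k + 1) / 2) := by
      exact_mod_cast hcard
    refine le_of_mul_le_mul_right (a := (2 : ℝ) ^ k * (k : ℝ) ^ ((k + 1) / 2)) ?_ (by positivity)
    linarith
  refine ⟨fun i => F.equivFin.symm (Fin.castLE hm i), fun i => ?_, fun i j hij => ?_⟩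
  · exact Finset.mem_powersetCard.1 (hFU (F.equivFin.symm _).2)
  · have := hF _ (F.equivFin.symm (Fin.castLE hm i)).2 _ (F.equivFin.symm (Fin.castLE hm j)).2
      fun h => hij.ne <| Fin.castLE_injective hm <| F.equivFin.symm.injective <| Subtype.ext h
    dsimp only
    omega
end

section
/- For all sufficiently large n the following holds. Let v₁, …, v_n ∈ ℝⁿ be unit vectors with ⟨v_i, v_j⟩ = −1/(n−1) for all i ≠ j, let 1 ≤ k ≤ (n+3)/4, and for a k-element subset I ⊆ {1, …, n} set v_I := (∑_{i∈I} v_i)/|∑_{i∈I} v_i|. If I and J are k-element subsets of {1, …, n} with |I ∩ J| < k/2, then ⟨v_I, v_J⟩ ≤ 3/4. -/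
open RealInnerProductSpace

/-- The inner product of two partial sums of the vertices of a regular simplex. -/
theorem inner_sum_sum_of_simplex {ι E : Type*} [DecidableEq ι] [NormedAddCommGroup E]
    [InnerProductSpace ℝ E] {n : ℝ} (hn : n ≠ 1) {v : ι → E} (hv : ∀ i, ‖v i‖ = 1)
    (hvv : ∀ i j, i ≠ j → ⟪v i, v j⟫ = -1 / (n - 1)) (I J : Finset ι) :
    ⟪∑ i ∈ I, v i, ∑ j ∈ J, v j⟫ =
      (((I ∩ J).card : ℝ) * n - (I.card : ℝ) * (J.card : ℝ)) / (n - 1) := by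
  have hn' : n - 1 ≠ 0 := sub_ne_zero.mpr hn
  have h : ∀ i j, ⟪v i, v j⟫ = (if i = j then n / (n - 1) else 0) - 1 / (n - 1) := by
    intro i j
    split_ifs with hij
    · subst hij
      rw [real_inner_self_eq_norm_sq, hv]
      field_simp
    · rw [hvv i j hij]
      ring
  simp_rw [sum_inner, inner_sum, h, Finset.sum_sub_distrib, Finset.sum_ite_eq,
    ← Finset.sum_filter, Finset.filter_mem_eq_inter, Finset.sum_const, nsmul_eq_mul]
  ring

theorem inner_normalized_sums_le
    : ∀ᶠ n : ℕ in Filter.atTop,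
      ∀ v : Fin n → EuclideanSpace ℝ (Fin n),
        (∀ i, ‖v i‖ = 1) →
        (∀ i j, i ≠ j → ⟪v i, v j⟫ = -1 / ((n : ℝ) - 1)) →
        ∀ k : ℕ, 1 ≤ k → (k : ℝ) ≤ ((n : ℝ) + 3) / 4 →
        ∀ I J : Finset (Fin n), I.card = k → J.card = k →
          2 * (I ∩ J).card < k →
          ⟪‖∑ i ∈ I, v i‖⁻¹ • ∑ i ∈ I, v i, ‖∑ j ∈ J, v j‖⁻¹ • ∑ j ∈ J, v j⟫ ≤ 3 / 4 := by
  filter_upwards [Filter.eventually_ge_atTop 2] with n hn v hv hvv k hk hkn I J hI hJ hIJ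
  have hn2 : (2 : ℝ) ≤ n := by exact_mod_cast hn
  have hk1 : (1 : ℝ) ≤ k := by exact_mod_cast hk
  have hm : 2 * ((I ∩ J).card : ℝ) ≤ k := by exact_mod_cast hIJ.le
  have hn1 : (n : ℝ) ≠ 1 := by linarith
  have hpos : 0 < (k : ℝ) * (n - k) / (n - 1) :=
    div_pos (mul_pos (by linarith) (by linarith)) (by linarith)
  have hnorm : ∀ K : Finset (Fin n), K.card = k →
      ‖∑ i ∈ K, v i‖ = √((k : ℝ) * (n - k) / (n - 1)) := by
    intro K hK
    rw [norm_eq_sqrt_real_inner, inner_sum_sum_of_simplex hn1 hv hvv, Finset.inter_self, hK,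
      mul_sub]
  rw [real_inner_smul_left, real_inner_smul_right, hnorm I hI, hnorm J hJ, ← mul_assoc,
    ← mul_inv, Real.mul_self_sqrt hpos.le, inv_mul_le_iff₀ hpos,
    inner_sum_sum_of_simplex hn1 hv hvv, hI, hJ, div_mul_eq_mul_div]
  refine div_le_div_of_nonneg_right ?_ (by linarith)
  nlinarith
end
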